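/- arXiv:1902.10894 — 2 statements merged into one kernel-verified Lean document; each statement's English description precedes it below -/
import Mathlib

section
/- Let (X(t), a ≤ t ≤ b) be a centered Gaussian process with continuous sample paths and P(min_{a≤t≤b} X(t) > 0) > 0, such that an optimal measure ν* for the minimization of I(ν) = ∫∫ R_X(s,t) ν(ds) ν(dt) over Borel probability measures on [a,b] has full support in [a,b]. Suppose there exist β > 0, c ∈ (0,∞) and a function σ : [0,∞) → [0,∞) with lim_{h↓0} h^{−β} σ(h) = c, such that E[(X(t) − X(s))²] ≤ σ(|t−s|)² for all s, t ∈ [a,b]. Then liminf_{u→∞} u^{−1/(β+1)} ( log P(min_{a≤t≤b} X(t) > u) + u²/(2σ*²(a,b)) ) > −∞, where σ*²(a,b) is the minimal value of I. -/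
open MeasureTheory ProbabilityTheory Filter Set

/-- The topological support of a Borel measure on `ℝ`. -/
def measSupport (ν : Measure ℝ) : Set ℝ :=
  {x | ∀ U : Set ℝ, IsOpen U → x ∈ U → 0 < ν U}

/-- The energy functional `I(ν) = ∫∫ R(s,t) ν(ds) ν(dt)`. -/
noncomputable def kernelEnergy (R : ℝ → ℝ → ℝ) (ν : Measure ℝ) : ℝ :=
  ∫ s, ∫ t, R s t ∂ν ∂ν

lemma sum_Icc_exp_neg_mul_abs_le {l : ℝ} (hl : 0 < l) (N : ℕ) :
    ∑ n ∈ Finset.Icc (-(N : ℤ)) N, Real.exp (-(l * |(n : ℝ)|)) ≤ 1 + 2 / l := by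
  have key : ∑ n ∈ Finset.Icc (-(N : ℤ)) N, Real.exp (-(l * |(n : ℝ)|))
      ≤ 1 + 2 * (1 - Real.exp (-(l * N))) / l := by
    induction N with
    | zero => simp
    | succ N ih =>
      have hset : Finset.Icc (-((N + 1 : ℕ) : ℤ)) ((N + 1 : ℕ) : ℤ)
          = insert (-((N : ℤ) + 1)) (insert ((N : ℤ) + 1) (Finset.Icc (-(N : ℤ)) N)) := by
        ext n
        simp only [Finset.mem_Icc, Finset.mem_insert]
        push_cast
        omega
      rw [hset, Finset.sum_insert, Finset.sum_insert]
      · have habs : |((N : ℝ) + 1)| = (N : ℝ) + 1 := abs_of_nonneg (by positivity)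
        have hstep : Real.exp (-(l * ((N : ℝ) + 1)))
            ≤ (Real.exp (-(l * N)) - Real.exp (-(l * ((N : ℝ) + 1)))) / l := by
          rw [le_div_iff₀ hl]
          have h1 : Real.exp (-(l * N)) = Real.exp (-(l * ((N : ℝ) + 1))) * Real.exp l := by
            rw [← Real.exp_add]; ring_nf
          rw [h1]
          nlinarith [Real.add_one_le_exp l, Real.exp_pos (-(l * ((N : ℝ) + 1)))]
        have e1 : 2 * (1 - Real.exp (-(l * ((N : ℝ) + 1)))) / l
            = 2 * (1 - Real.exp (-(l * N))) / l
              + 2 * ((Real.exp (-(l * N)) - Real.exp (-(l * ((N : ℝ) + 1)))) / l) := by ring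
        push_cast
        rw [abs_neg, habs, e1]
        linarith
      · simp
      · simp only [Finset.mem_Icc, Finset.mem_insert]
        omega
  refine key.trans ?_
  gcongr
  linarith [Real.exp_pos (-(l * N))]

/-- Two independent copies of a random vector are within distance one of each other coordinatewise
with probability bounded below by the exponential of a coding length of the rounded vector. -/
lemma prod_real_forall_abs_sub_le_one_ge {Ω ι : Type*} [MeasurableSpace Ω] [Fintype ι]
    (μ : Measure Ω) [IsProbabilityMeasure μ] (x : ι → Ω → ℝ) (hx : ∀ i, Measurable (x i))
    (l : ι → ℝ) (hl : ∀ i, 0 < l i)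
    (hint : ∀ i, Integrable (fun ω => |(round (x i ω) : ℝ)|) μ) {L : ℝ} (hL0 : 0 < L)
    (hL : ∑ i, (Real.log (1 + 2 / l i) + l i * ∫ ω, |(round (x i ω) : ℝ)| ∂μ) ≤ L) :
    1 / 4 * Real.exp (-(2 * L))
      ≤ (μ.prod μ).real {p | ∀ i, |x i p.1 - x i p.2| ≤ 1} := by
  classical
  set m : Ω → ι → ℤ := fun ω i => round (x i ω) with hm
  have hmm : Measurable m := measurable_pi_lambda _ fun i => by
    change Measurable fun ω => round (x i ω)
    simp only [round_eq]
    exact ((hx i).add_const _).floor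
  set Φ : (ι → ℤ) → ℝ := fun k => ∑ i, (Real.log (1 + 2 / l i) + l i * |(k i : ℝ)|) with hΦ
  have hlog : ∀ i, 0 ≤ Real.log (1 + 2 / l i) := fun i =>
    Real.log_nonneg (by have := hl i; simp; positivity)
  have hΦterm : ∀ k i, 0 ≤ Real.log (1 + 2 / l i) + l i * |((k : ι → ℤ) i : ℝ)| := fun k i =>
    add_nonneg (hlog i) (mul_nonneg (hl i).le (abs_nonneg _))
  have hΦ0 : ∀ k, 0 ≤ Φ k := fun k => Finset.sum_nonneg fun i _ => hΦterm k i
  have hterm : ∀ i, Integrable (fun ω => Real.log (1 + 2 / l i) + l i * |(m ω i : ℝ)|) μ :=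
    fun i => (integrable_const _).add ((hint i).const_mul _)
  have hΦint : Integrable (fun ω => Φ (m ω)) μ := integrable_finsetSum _ fun i _ => hterm i
  have hΦI : ∫ ω, Φ (m ω) ∂μ ≤ L := by
    refine le_trans (le_of_eq ?_) hL
    simp only [hΦ]
    rw [integral_finsetSum _ fun i _ => hterm i]
    refine Finset.sum_congr rfl fun i _ => ?_
    rw [integral_add (integrable_const _) ((hint i).const_mul _), integral_const_mul]
    simp
  set T : Finset (ι → ℤ) :=
    (Fintype.piFinset fun i => Finset.Icc (-((⌈2 * L / l i⌉₊ : ℕ) : ℤ)) (⌈2 * L / l i⌉₊ : ℕ)).filter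
      (fun k => Φ k ≤ 2 * L) with hT
  have hTmem : ∀ k, Φ k ≤ 2 * L → k ∈ T := by
    intro k hk
    rw [hT, Finset.mem_filter, Fintype.mem_piFinset]
    refine ⟨fun i => ?_, hk⟩
    have h1 : l i * |(k i : ℝ)| ≤ 2 * L := by
      have := Finset.single_le_sum (f := fun i => Real.log (1 + 2 / l i) + l i * |(k i : ℝ)|)
        (fun j _ => hΦterm k j) (Finset.mem_univ i)
      have h2 := hlog i
      simp only [hΦ] at hk
      linarith
    have h2 : |(k i : ℝ)| ≤ 2 * L / l i := by
      rw [le_div_iff₀ (hl i)]; linarith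
    have h3 := h2.trans (Nat.le_ceil _)
    rw [abs_le] at h3
    rw [Finset.mem_Icc]
    exact ⟨by exact_mod_cast h3.1, by exact_mod_cast h3.2⟩
  have hcard : (T.card : ℝ) ≤ Real.exp (2 * L) := by
    have h1 : ∑ k ∈ T, Real.exp (-Φ k) ≤ 1 := by
      calc ∑ k ∈ T, Real.exp (-Φ k)
          ≤ ∑ k ∈ Fintype.piFinset fun i =>
              Finset.Icc (-((⌈2 * L / l i⌉₊ : ℕ) : ℤ)) (⌈2 * L / l i⌉₊ : ℕ), Real.exp (-Φ k) :=
            Finset.sum_le_sum_of_subset_of_nonneg (Finset.filter_subset _ _)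
              fun _ _ _ => (Real.exp_pos _).le
        _ = ∑ k ∈ Fintype.piFinset fun i =>
              Finset.Icc (-((⌈2 * L / l i⌉₊ : ℕ) : ℤ)) (⌈2 * L / l i⌉₊ : ℕ),
              ∏ i, ((1 + 2 / l i)⁻¹ * Real.exp (-(l i * |(k i : ℝ)|))) := by
            refine Finset.sum_congr rfl fun k _ => ?_
            simp only [hΦ]
            rw [← Finset.sum_neg_distrib, Real.exp_sum]
            refine Finset.prod_congr rfl fun i _ => ?_
            have := hl i
            rw [neg_add, Real.exp_add, Real.exp_neg, Real.exp_log (by positivity)]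
        _ = ∏ i, ∑ n ∈ Finset.Icc (-((⌈2 * L / l i⌉₊ : ℕ) : ℤ)) (⌈2 * L / l i⌉₊ : ℕ),
              ((1 + 2 / l i)⁻¹ * Real.exp (-(l i * |(n : ℝ)|))) :=
            (Finset.prod_univ_sum (fun i => Finset.Icc (-((⌈2 * L / l i⌉₊ : ℕ) : ℤ))
              (⌈2 * L / l i⌉₊ : ℕ)) (fun i n => (1 + 2 / l i)⁻¹ *
                Real.exp (-(l i * |((n : ℤ) : ℝ)|)))).symm
        _ ≤ 1 := by
            refine Finset.prod_le_one (fun i _ => Finset.sum_nonneg fun n _ => ?_) fun i _ => ?_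
            · have := hl i
              positivity
            · have := hl i
              rw [← Finset.mul_sum, inv_mul_le_one₀ (by positivity)]
              exact sum_Icc_exp_neg_mul_abs_le (hl i) _
    have h2 : (T.card : ℝ) * Real.exp (-(2 * L)) ≤ ∑ k ∈ T, Real.exp (-Φ k) := by
      rw [← nsmul_eq_mul]
      refine Finset.card_nsmul_le_sum _ _ _ fun k hk => ?_
      rw [hT, Finset.mem_filter] at hk
      exact Real.exp_le_exp.2 (neg_le_neg hk.2)
    have h3 := h2.trans h1
    rw [Real.exp_neg, ← div_eq_mul_inv, div_le_one (Real.exp_pos _)] at h3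
    exact h3
  have hmeas : ∀ k, MeasurableSet (m ⁻¹' {k}) := fun k => hmm (measurableSet_singleton k)
  have hhalf : 1 / 2 ≤ ∑ k ∈ T, μ.real (m ⁻¹' {k}) := by
    have hmk : 2 * L * μ.real {ω | 2 * L ≤ Φ (m ω)} ≤ ∫ ω, Φ (m ω) ∂μ :=
      mul_meas_ge_le_integral_of_nonneg (ae_of_all _ fun ω => hΦ0 _) hΦint _
    have h1 : μ.real {ω | 2 * L ≤ Φ (m ω)} ≤ 1 / 2 := by
      have h := hmk.trans hΦI
      by_contra hcon
      push Not at hcon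
      nlinarith
    have h2 : (1 : ℝ) ≤ μ.real {ω | 2 * L ≤ Φ (m ω)} + μ.real (⋃ k ∈ T, m ⁻¹' {k}) := by
      have : (Set.univ : Set Ω) ⊆ {ω | 2 * L ≤ Φ (m ω)} ∪ ⋃ k ∈ T, m ⁻¹' {k} := by
        intro ω _
        rcases le_total (2 * L) (Φ (m ω)) with h | h
        · exact Or.inl h
        · exact Or.inr (Set.mem_biUnion (hTmem _ h) rfl)
      calc (1 : ℝ) = μ.real Set.univ := by simp
        _ ≤ _ := measureReal_mono this
        _ ≤ _ := measureReal_union_le _ _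
    have h3 := measureReal_biUnion_finset_le (μ := μ) T (fun k => m ⁻¹' {k})
    linarith
  have hsub : ∑ k ∈ T, μ.real (m ⁻¹' {k}) ^ 2
      ≤ (μ.prod μ).real {p | ∀ i, |x i p.1 - x i p.2| ≤ 1} := by
    have h1 : ∀ k ∈ T, μ.real (m ⁻¹' {k}) ^ 2
        = (μ.prod μ).real ((m ⁻¹' {k}) ×ˢ (m ⁻¹' {k})) := fun k _ => by
      rw [measureReal_prod_prod, sq]
    rw [Finset.sum_congr rfl h1, ← measureReal_biUnion_finset]
    · refine measureReal_mono ?_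
      intro p hp i
      simp only [Set.mem_iUnion, Set.mem_prod, Set.mem_preimage, Set.mem_singleton_iff] at hp
      obtain ⟨k, _, h1, h2⟩ := hp
      have e : (round (x i p.1) : ℝ) = round (x i p.2) := by
        have := congrFun (h1.trans h2.symm) i
        exact_mod_cast this
      have a1 := abs_le.1 (abs_sub_round (x i p.1))
      have a2 := abs_le.1 (abs_sub_round (x i p.2))
      rw [abs_le]
      constructor <;> linarith [a1.1, a1.2, a2.1, a2.2]
    · intro k _ k' _ hkk
      refine Set.disjoint_left.2 fun p hp hp' => hkk ?_
      exact hp.1.symm.trans hp'.1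
    · exact fun k _ => (hmeas k).prod (hmeas k)
  have hcs := sq_sum_le_card_mul_sum_sq (s := T) (f := fun k => μ.real (m ⁻¹' {k}))
  have hS : 0 ≤ ∑ k ∈ T, μ.real (m ⁻¹' {k}) ^ 2 := Finset.sum_nonneg fun _ _ => sq_nonneg _
  have h4 : 1 / 4 ≤ Real.exp (2 * L) * ∑ k ∈ T, μ.real (m ⁻¹' {k}) ^ 2 := by
    have := mul_le_mul_of_nonneg_right hcard hS
    nlinarith
  rw [Real.exp_neg, ← div_eq_mul_inv, div_le_iff₀ (Real.exp_pos _)]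
  nlinarith [Real.exp_pos (2 * L)]

/-- A centered Gaussian vector falls in the unit cube at least as often as the difference of two
independent copies does. -/
lemma prod_real_forall_abs_sub_le_one_le {ι : Type*} [Fintype ι] (μ : Measure (ι → ℝ))
    [IsGaussian μ] (hμ : μ[id] = 0) :
    (μ.prod μ).real {p | ∀ i, |p.1 i - p.2 i| ≤ 1} ≤ μ.real {y | ∀ i, |y i| ≤ 1} := by
  have hB : MeasurableSet {y : ι → ℝ | ∀ i, |y i| ≤ 1} := by
    rw [Set.ofPred_forall]
    exact MeasurableSet.iInter fun i => measurableSet_le (by fun_prop) measurable_const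
  have hrot := IsGaussian.map_rotation_eq_self hμ (-(Real.pi / 4))
  have h1 : μ.real {y : ι → ℝ | ∀ i, |y i| ≤ 1}
      = (μ.prod μ).real ({y : ι → ℝ | ∀ i, |y i| ≤ 1} ×ˢ (Set.univ : Set (ι → ℝ))) := by
    rw [measureReal_prod_prod]; simp
  rw [h1, ← hrot, map_measureReal_apply (by fun_prop) (hB.prod MeasurableSet.univ), hrot]
  refine measureReal_mono ?_
  intro p hp
  refine ⟨fun i => ?_, Set.mem_univ _⟩
  have h2 := hp i
  simp only [ContinuousLinearMap.rotation_apply, Real.cos_neg, Real.sin_neg, Real.cos_pi_div_four,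
    Real.sin_pi_div_four, Pi.add_apply, Pi.smul_apply, smul_eq_mul]
  have e : Real.sqrt 2 / 2 * p.1 i + -(Real.sqrt 2 / 2) * p.2 i
      = Real.sqrt 2 / 2 * (p.1 i - p.2 i) := by ring
  rw [e, abs_mul, abs_of_nonneg (by positivity)]
  have h3 : Real.sqrt 2 / 2 ≤ 1 := by
    have := Real.sqrt_le_sqrt (show (2 : ℝ) ≤ 4 by norm_num)
    rw [show (4 : ℝ) = 2 ^ 2 by norm_num, Real.sqrt_sq (by norm_num)] at this
    linarith
  nlinarith [abs_nonneg (p.1 i - p.2 i)]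

/-- A linear space of square-integrable random variables, all of which are centered Gaussian. -/
def IsGaussianSubspace {Ω : Type*} [MeasurableSpace Ω] (P : Measure Ω)
    (H : Submodule ℝ (Lp ℝ 2 P)) : Prop :=
  ∀ f ∈ H, P.map f = gaussianReal 0 (‖f‖₊ ^ 2)

lemma Lp_two_norm_sq {Ω : Type*} [MeasurableSpace Ω] {P : Measure Ω} (f : Lp ℝ 2 P) :
    ‖f‖ ^ 2 = ∫ ω, f ω ^ 2 ∂P := by
  rw [← real_inner_self_eq_norm_sq, L2.inner_def]
  refine integral_congr_ae (ae_of_all _ fun ω => ?_)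
  simp [sq]

lemma Lp_two_aemeasurable {Ω : Type*} [MeasurableSpace Ω] {P : Measure Ω} (f : Lp ℝ 2 P) :
    AEMeasurable f P := (Lp.aestronglyMeasurable f).aemeasurable

lemma map_eq_gaussianReal_norm_sq {Ω : Type*} [MeasurableSpace Ω] {P : Measure Ω}
    {f : Lp ℝ 2 P} {v : NNReal} (h : P.map f = gaussianReal 0 v) :
    P.map f = gaussianReal 0 (‖f‖₊ ^ 2) := by
  suffices hv : v = ‖f‖₊ ^ 2 by rw [h, hv]
  have h1 : ∫ x, x ^ 2 ∂(gaussianReal 0 v) = v := by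
    have := variance_of_integral_eq_zero (X := fun x : ℝ => x) (μ := gaussianReal 0 v)
      (by fun_prop) (by simp)
    rw [← this]; simp
  rw [← h, integral_map (Lp_two_aemeasurable f) (by fun_prop), ← Lp_two_norm_sq] at h1
  ext
  rw [← h1]; simp

lemma charFun_map_eq_of_gaussian {Ω : Type*} [MeasurableSpace Ω] {P : Measure Ω}
    {f : Lp ℝ 2 P} (h : P.map f = gaussianReal 0 (‖f‖₊ ^ 2)) (t : ℝ) :
    charFun (P.map f) t = Complex.exp (-((‖f‖ : ℂ) ^ 2 * t ^ 2 / 2)) := by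
  rw [h, charFun_gaussianReal]
  simp

lemma dist_charFun_map_le {Ω : Type*} [MeasurableSpace Ω] {P : Measure Ω} [IsProbabilityMeasure P]
    (f g : Lp ℝ 2 P) (t : ℝ) :
    dist (charFun (P.map f) t) (charFun (P.map g) t) ≤ |t| * dist f g := by
  have hf := Lp_two_aemeasurable f
  have hg := Lp_two_aemeasurable g
  have hint : ∀ k : Lp ℝ 2 P, Integrable (fun ω => Complex.exp (t * k ω * Complex.I)) P := by
    intro k
    refine Integrable.of_bound (C := 1) ?_ (ae_of_all _ fun ω => ?_)
    · have := Lp_two_aemeasurable k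
      exact AEMeasurable.aestronglyMeasurable (by fun_prop)
    · rw [← Complex.ofReal_mul, Complex.norm_exp_ofReal_mul_I]
  have hlp : ∀ ω, ‖Complex.exp (t * f ω * Complex.I) - Complex.exp (t * g ω * Complex.I)‖
      ≤ |t| * |f ω - g ω| := by
    intro ω
    have e : Complex.exp (t * f ω * Complex.I) - Complex.exp (t * g ω * Complex.I)
        = Complex.exp (t * g ω * Complex.I) *
          (Complex.exp (Complex.I * ((t * (f ω - g ω) : ℝ) : ℂ)) - 1) := by
      rw [mul_sub, ← Complex.exp_add]
      push_cast
      ring_nf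
    rw [e, norm_mul, ← Complex.ofReal_mul, Complex.norm_exp_ofReal_mul_I, one_mul, ← abs_mul]
    exact Real.norm_exp_I_mul_ofReal_sub_one_le
  have hL2 : MemLp (fun ω => f ω - g ω) 2 P := (Lp.memLp f).sub (Lp.memLp g)
  have hL1 : Integrable (fun ω => |f ω - g ω|) P := (hL2.integrable (by norm_num)).abs
  have hCS : ∫ ω, |f ω - g ω| ∂P ≤ dist f g := by
    have h1 : (∫ ω, |f ω - g ω| ∂P) ^ 2 ≤ ‖f - g‖ ^ 2 := by
      rw [Lp_two_norm_sq]
      have e : ∫ ω, (f - g : Lp ℝ 2 P) ω ^ 2 ∂P = ∫ ω, |f ω - g ω| ^ 2 ∂P := by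
        refine integral_congr_ae ?_
        filter_upwards [Lp.coeFn_sub f g] with ω hω
        rw [hω, sq_abs]; rfl
      rw [e]
      have hv := variance_nonneg (fun ω => |f ω - g ω|) P
      rw [variance_eq_sub (X := fun ω => |f ω - g ω|) hL2.abs] at hv
      simp only [Pi.pow_apply] at hv
      linarith
    rw [dist_eq_norm]
    exact abs_le_of_sq_le_sq' h1 (norm_nonneg _) |>.2
  rw [charFun_apply_real, charFun_apply_real, integral_map hf (by fun_prop),
    integral_map hg (by fun_prop), dist_eq_norm, ← integral_sub (hint f) (hint g)]
  calc _ ≤ ∫ ω, |t| * |f ω - g ω| ∂P :=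
        norm_integral_le_of_norm_le (hL1.const_mul _) (ae_of_all _ hlp)
    _ = |t| * ∫ ω, |f ω - g ω| ∂P := integral_const_mul _ _
    _ ≤ _ := by gcongr

lemma IsGaussianSubspace.topologicalClosure {Ω : Type*} [MeasurableSpace Ω] {P : Measure Ω}
    [IsProbabilityMeasure P] {H : Submodule ℝ (Lp ℝ 2 P)} (hH : IsGaussianSubspace P H) :
    IsGaussianSubspace P H.topologicalClosure := by
  intro f hf
  rw [← SetLike.mem_coe, Submodule.topologicalClosure_coe, mem_closure_iff_seq_limit] at hf
  obtain ⟨u, hu, hlim⟩ := hf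
  have := Measure.isProbabilityMeasure_map (Lp_two_aemeasurable f)
  refine Measure.ext_of_charFun (funext fun t => ?_)
  have h1 : Tendsto (fun n => charFun (P.map (u n)) t) atTop (nhds (charFun (P.map f) t)) := by
    rw [tendsto_iff_dist_tendsto_zero] at hlim ⊢
    refine squeeze_zero (fun _ => dist_nonneg) (fun n => dist_charFun_map_le (u n) f t) ?_
    simpa using hlim.const_mul |t|
  have h2 : Tendsto (fun n => charFun (P.map (u n)) t) atTop
      (nhds (Complex.exp (-((‖f‖ : ℂ) ^ 2 * t ^ 2 / 2)))) := by
    have e : ∀ n, charFun (P.map (u n)) t = Complex.exp (-((‖u n‖ : ℂ) ^ 2 * t ^ 2 / 2)) :=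
      fun n => charFun_map_eq_of_gaussian (hH _ (hu n)) t
    simp_rw [e]
    have hn : Tendsto (fun n => (‖u n‖ : ℂ)) atTop (nhds (‖f‖ : ℂ)) :=
      (Complex.continuous_ofReal.tendsto _).comp hlim.norm
    have hc : Continuous fun z : ℂ => Complex.exp (-(z ^ 2 * t ^ 2 / 2)) := by fun_prop
    exact (hc.tendsto _).comp hn
  rw [tendsto_nhds_unique h1 h2, charFun_gaussianReal]
  simp

lemma coeFn_sum_smul {Ω ι : Type*} [MeasurableSpace Ω] {P : Measure Ω} [Fintype ι] (c : ι → ℝ)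
    (f : ι → Lp ℝ 2 P) :
    (∑ i, c i • f i : Lp ℝ 2 P) =ᵐ[P] fun ω => ∑ i, c i * f i ω := by
  have h := Lp.coeFn_finsetSum (Finset.univ) (fun i => c i • f i)
  have h2 : ∀ᵐ ω ∂P, ∀ i, (c i • f i : Lp ℝ 2 P) ω = c i * f i ω := by
    rw [ae_all_iff]
    intro i
    filter_upwards [Lp.coeFn_smul (c i) (f i)] with ω hω
    rw [hω]; rfl
  filter_upwards [h, h2] with ω h1 h2
  rw [h1, Finset.sum_apply]
  exact Finset.sum_congr rfl fun i _ => h2 i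

lemma IsGaussianSubspace.isGaussian_map {Ω ι : Type*} [MeasurableSpace Ω] {P : Measure Ω}
    [Fintype ι] {H : Submodule ℝ (Lp ℝ 2 P)} (hH : IsGaussianSubspace P H)
    (f : ι → Lp ℝ 2 P) (hf : ∀ i, f i ∈ H) :
    IsGaussian (P.map fun ω i => f i ω) := by
  classical
  have hm : AEMeasurable (fun ω i => f i ω) P :=
    aemeasurable_pi_lambda _ fun i => Lp_two_aemeasurable (f i)
  refine isGaussian_of_map_eq_gaussianReal fun L => ⟨0, ‖∑ i, L (Pi.single i 1) • f i‖₊ ^ 2, ?_⟩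
  rw [← hH _ (H.sum_mem fun i _ => H.smul_mem _ (hf i)),
    AEMeasurable.map_map_of_aemeasurable (by fun_prop) hm]
  refine Measure.map_congr ?_
  filter_upwards [coeFn_sum_smul (fun i => L (Pi.single i 1)) f] with ω hω
  rw [hω, Function.comp_apply, ← ContinuousLinearMap.coe_coe, LinearMap.pi_apply_eq_sum_univ]
  exact Finset.sum_congr rfl fun i _ => by
    rw [smul_eq_mul, mul_comm, ContinuousLinearMap.coe_coe]
    congr 2
    ext j
    simp [Pi.single_apply, eq_comm]

lemma IsGaussianSubspace.integral_eq_zero {Ω : Type*} [MeasurableSpace Ω] {P : Measure Ω}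
    {H : Submodule ℝ (Lp ℝ 2 P)} (hH : IsGaussianSubspace P H) {f : Lp ℝ 2 P} (hf : f ∈ H) :
    ∫ ω, f ω ∂P = 0 := by
  have h : ∫ x, x ∂(P.map f) = 0 := by rw [hH f hf]; simp
  rwa [integral_map (Lp_two_aemeasurable f) (by fun_prop)] at h

/-- Orthogonality implies independence within a Gaussian subspace. -/
lemma IsGaussianSubspace.indepFun {Ω ι : Type*} [MeasurableSpace Ω] {P : Measure Ω}
    [IsProbabilityMeasure P] [Fintype ι] {H : Submodule ℝ (Lp ℝ 2 P)} (hH : IsGaussianSubspace P H)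
    (Y : Lp ℝ 2 P) (hY : Y ∈ H) (f : ι → Lp ℝ 2 P) (hf : ∀ i, f i ∈ H)
    (h : ∀ i, inner ℝ Y (f i) = 0) :
    IndepFun (fun ω (_ : Unit) => Y ω) (fun ω i => f i ω) P := by
  refine HasGaussianLaw.indepFun_of_covariance_eval (X := fun _ => Y) (Y := fun i => f i) ?_ ?_
  · have hg := hH.isGaussian_map (fun o : Option ι => o.elim Y f) (by
      rintro (_ | i)
      · exact hY
      · exact hf i)
    have hG : HasGaussianLaw (fun ω (o : Option ι) => (o.elim Y f) ω) P := ⟨hg⟩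
    exact hG.map_fun ((ContinuousLinearMap.pi fun _ : Unit =>
      ContinuousLinearMap.proj (R := ℝ) (φ := fun _ : Option ι => ℝ) none).prod
      (ContinuousLinearMap.pi fun i : ι =>
        ContinuousLinearMap.proj (R := ℝ) (φ := fun _ : Option ι => ℝ) (some i)))
  · intro _ i
    rw [covariance_eq_sub (Lp.memLp Y) (Lp.memLp (f i)), hH.integral_eq_zero hY, zero_mul, sub_zero]
    have := h i
    rw [L2.inner_def] at this
    rw [← this]
    refine integral_congr_ae (ae_of_all _ fun ω => ?_)
    simp [mul_comm]

/-- Small-ball estimate for a finite centered Gaussian family in terms of a coding length. -/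
lemma IsGaussianSubspace.real_forall_abs_le_one_ge {Ω ι : Type*} [MeasurableSpace Ω]
    {P : Measure Ω} [IsProbabilityMeasure P] [Fintype ι] {H : Submodule ℝ (Lp ℝ 2 P)}
    (hH : IsGaussianSubspace P H) (f : ι → Lp ℝ 2 P) (hf : ∀ i, f i ∈ H)
    (l : ι → ℝ) (hl : ∀ i, 0 < l i) {L : ℝ} (hL0 : 0 < L)
    (hL : ∑ i, (Real.log (1 + 2 / l i) + l i * ∫ ω, |(round (f i ω) : ℝ)| ∂P) ≤ L) :
    1 / 4 * Real.exp (-(2 * L)) ≤ P.real {ω | ∀ i, |f i ω| ≤ 1} := by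
  have hm : AEMeasurable (fun ω i => f i ω) P :=
    aemeasurable_pi_lambda _ fun i => Lp_two_aemeasurable (f i)
  have hg := hH.isGaussian_map f hf
  have hround : Measurable fun y : ℝ => |(round y : ℝ)| := by
    simp only [round_eq]
    fun_prop
  have hround' : ∀ i, Measurable fun y : ι → ℝ => |(round (y i) : ℝ)| := fun i =>
    hround.comp (measurable_pi_apply i)
  have hmean : ∫ y, id y ∂(P.map fun ω i => f i ω) = 0 := by
    ext i
    have hi : Integrable id (P.map fun ω i => f i ω) := IsGaussian.integrable_id
    rw [eval_integral fun i => hi.eval i]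
    simp only [id_eq]
    rw [integral_map hm (f := fun y : ι → ℝ => y i) (measurable_pi_apply i).aestronglyMeasurable]
    exact hH.integral_eq_zero (hf i)
  have hbound : ∀ y : ℝ, |(round y : ℝ)| ≤ |y| + 1 := fun y => by
    have h1 := abs_sub_round y
    have h2 := abs_sub_abs_le_abs_sub (round y : ℝ) y
    rw [abs_sub_comm] at h2
    linarith
  have key := (prod_real_forall_abs_sub_le_one_ge (P.map fun ω i => f i ω)
    (fun i y => y i) (fun i => by fun_prop) l hl ?_ hL0 ?_).trans
      (prod_real_forall_abs_sub_le_one_le _ hmean)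
  · rw [map_measureReal_apply_of_aemeasurable hm ?_] at key
    · exact key
    · rw [Set.ofPred_forall]
      exact MeasurableSet.iInter fun i => measurableSet_le (by fun_prop) measurable_const
  · intro i
    rw [integrable_map_measure (hround' i).aestronglyMeasurable hm]
    have h1 : Integrable (f i) P := (Lp.memLp (f i)).integrable (by norm_num)
    refine (h1.abs.add (integrable_const 1)).mono' ?_ (ae_of_all _ fun ω => ?_)
    · exact (hround.comp_aemeasurable (Lp_two_aemeasurable (f i))).aestronglyMeasurable
    · simpa using hbound (f i ω)
  · refine le_trans (le_of_eq ?_) hL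
    refine Finset.sum_congr rfl fun i _ => ?_
    rw [integral_map hm (hround' i).aestronglyMeasurable]

lemma abs_round_le_pow (x : ℝ) {n : ℕ} (hn : n ≠ 0) : |(round x : ℝ)| ≤ (2 * |x|) ^ n := by
  by_cases h : round x = 0
  · simp [h]
  have h1 : (1 : ℝ) ≤ |(round x : ℝ)| := by exact_mod_cast Int.one_le_abs h
  have h2 := abs_sub_round x
  have h3 := abs_sub_abs_le_abs_sub (round x : ℝ) x
  rw [abs_sub_comm] at h3
  exact (by linarith : |(round x : ℝ)| ≤ 2 * |x|).trans (le_self_pow₀ (by linarith) hn)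

lemma exists_integral_abs_round_le {n : ℕ} (hn : n ≠ 0) :
    ∃ M : ℝ, 0 ≤ M ∧ ∀ {Ω : Type*} [MeasurableSpace Ω] (P : Measure Ω) (f : Lp ℝ 2 P),
      P.map f = gaussianReal 0 (‖f‖₊ ^ 2) → ∫ ω, |(round (f ω) : ℝ)| ∂P ≤ M * ‖f‖ ^ n := by
  refine ⟨∫ y, (2 * |y|) ^ n ∂(gaussianReal 0 1), integral_nonneg fun y => by positivity, ?_⟩
  intro Ω _ P f hf
  have hround : Measurable fun y : ℝ => |(round y : ℝ)| := by
    simp only [round_eq]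
    fun_prop
  have hscale : P.map f = (gaussianReal 0 1).map (‖f‖ * ·) := by
    rw [gaussianReal_map_const_mul, hf]
    congr 1
    · simp
    · ext; simp
  have hmom : Integrable (fun y : ℝ => (2 * |y|) ^ n) (gaussianReal 0 1) := by
    have := (memLp_id_gaussianReal (μ := 0) (v := 1) n).integrable_norm_pow hn
    simp_rw [mul_pow]
    exact this.const_mul _
  rw [← integral_map (f := fun y : ℝ => |(round y : ℝ)|) (Lp_two_aemeasurable f)
    hround.aestronglyMeasurable, hscale,
    integral_map (by fun_prop) hround.aestronglyMeasurable, ← integral_mul_const]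
  refine integral_mono_of_nonneg (ae_of_all _ fun y => abs_nonneg _) (hmom.mul_const _)
    (ae_of_all _ fun y => ?_)
  refine (abs_round_le_pow _ hn).trans (le_of_eq ?_)
  rw [abs_mul, abs_norm]
  ring

/-- Coding length of a rounded centered Gaussian variable in terms of a bound on its standard
deviation. -/
lemma exists_coding_length_le {C : ℝ} (hC : 0 ≤ C) {p : ℕ} (hp : p ≠ 0) {θ : ℝ} (hθ : 0 < θ) :
    ∃ A : ℝ, 0 < A ∧ ∀ τ : ℝ, 0 < τ → ∃ l : ℝ, 0 < l ∧
      ∀ {Ω : Type*} [MeasurableSpace Ω] (P : Measure Ω) (f : Lp ℝ 2 P),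
        P.map f = gaussianReal 0 (‖f‖₊ ^ 2) → ‖f‖ ≤ C * τ →
        Real.log (1 + 2 / l) + l * ∫ ω, |(round (f ω) : ℝ)| ∂P
          ≤ A * (if τ ≤ 1 then τ ^ p else τ ^ θ) := by
  obtain ⟨M, hM, hMle⟩ := exists_integral_abs_round_le (n := 2 * p) (by omega)
  have hE : ∀ {Ω : Type _} [MeasurableSpace Ω] (P : Measure Ω) (f : Lp ℝ 2 P) (τ : ℝ), 0 < τ →
      P.map f = gaussianReal 0 (‖f‖₊ ^ 2) → ‖f‖ ≤ C * τ →
      ∫ ω, |(round (f ω) : ℝ)| ∂P ≤ M * C ^ (2 * p) * τ ^ (2 * p) := by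
    intro Ω _ P f τ hτ hf hn
    refine (hMle P f hf).trans ?_
    rw [mul_assoc, ← mul_pow]
    gcongr
  set M' := M * C ^ (2 * p) with hM'
  have hM'0 : 0 ≤ M' := by positivity
  refine ⟨2 + 2 * p / θ + M', by positivity, fun τ hτ => ?_⟩
  by_cases h1 : τ ≤ 1
  · refine ⟨(τ ^ p)⁻¹, by positivity, ?_⟩
    intro Ω _ P f hf hn
    rw [if_pos h1]
    have h2 := hE P f τ hτ hf hn
    have h3 : Real.log (1 + 2 / (τ ^ p)⁻¹) ≤ 2 * τ ^ p := by
      have := Real.log_le_sub_one_of_pos (show 0 < 1 + 2 / (τ ^ p)⁻¹ by positivity)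
      rw [div_inv_eq_mul] at this ⊢
      linarith
    have h4 : (τ ^ p)⁻¹ * ∫ ω, |(round (f ω) : ℝ)| ∂P ≤ M' * τ ^ p := by
      rw [inv_mul_le_iff₀ (by positivity)]
      refine h2.trans (le_of_eq ?_)
      rw [two_mul, pow_add]
      ring
    have h5 : 0 ≤ 2 * p / θ * τ ^ p := by positivity
    linarith
  · refine ⟨(τ ^ (2 * p))⁻¹, by positivity, ?_⟩
    intro Ω _ P f hf hn
    rw [if_neg h1]
    push Not at h1
    have h2 := hE P f τ hτ hf hn
    have hp1 : 1 ≤ τ ^ (2 * p) := one_le_pow₀ h1.le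
    have hθ1 : 1 ≤ τ ^ θ := Real.one_le_rpow h1.le hθ.le
    have h3 : Real.log (1 + 2 / (τ ^ (2 * p))⁻¹) ≤ 2 + 2 * p / θ * τ ^ θ := by
      rw [div_inv_eq_mul]
      calc Real.log (1 + 2 * τ ^ (2 * p)) ≤ Real.log (3 * τ ^ (2 * p)) :=
            Real.log_le_log (by positivity) (by linarith)
        _ = Real.log 3 + 2 * p * Real.log τ := by
            rw [Real.log_mul (by norm_num) (by positivity), Real.log_pow]; push_cast; ring
        _ ≤ 2 + 2 * p * (τ ^ θ / θ) := by
            gcongr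
            · have := Real.log_le_sub_one_of_pos (show (0 : ℝ) < 3 by norm_num)
              linarith
            · exact Real.log_le_rpow_div hτ.le hθ
        _ = _ := by ring
    have h4 : (τ ^ (2 * p))⁻¹ * ∫ ω, |(round (f ω) : ℝ)| ∂P ≤ M' := by
      rw [inv_mul_le_iff₀ (by positivity)]
      linarith
    nlinarith

lemma sum_range_pow_dist_le {x : ℝ} (h0 : 0 ≤ x) (h1 : x < 1) (m n : ℕ) :
    ∑ k ∈ Finset.range n, x ^ ((k - m) + (m - k)) ≤ 2 / (1 - x) := by
  have hgeo : ∀ N : ℕ, ∑ k ∈ Finset.range N, x ^ k ≤ (1 - x)⁻¹ := fun N => by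
    rw [← tsum_geometric_of_lt_one h0 h1]
    exact (summable_geometric_of_lt_one h0 h1).sum_le_tsum _ fun _ _ => by positivity
  calc ∑ k ∈ Finset.range n, x ^ ((k - m) + (m - k))
      ≤ ∑ k ∈ Finset.range (m + n), x ^ ((k - m) + (m - k)) :=
        Finset.sum_le_sum_of_subset_of_nonneg (Finset.range_mono (by omega))
          fun _ _ _ => by positivity
    _ = ∑ k ∈ Finset.range m, x ^ ((k - m) + (m - k))
        + ∑ k ∈ Finset.range n, x ^ ((m + k - m) + (m - (m + k))) := Finset.sum_range_add _ _ _
    _ ≤ (1 - x)⁻¹ + (1 - x)⁻¹ := by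
        gcongr
        · refine le_trans ?_ (hgeo m)
          rw [← Finset.sum_range_reflect]
          refine Finset.sum_le_sum fun k hk => pow_le_pow_of_le_one h0 h1.le ?_
          rw [Finset.mem_range] at hk
          omega
        · refine le_trans (le_of_eq (Finset.sum_congr rfl fun k _ => ?_)) (hgeo n)
          congr 1
          omega
    _ = _ := by ring

/-- The increments of a family indexed by a dyadic tree. -/
noncomputable def treeIncrement {E : Type*} [AddCommGroup E] (D : ℕ → ℕ → E) : ℕ → ℕ → E
  | 0, i => D 0 i
  | k + 1, i => D (k + 1) i - D k (i / 2)

lemma abs_tree_le_sum {Ω : Type*} [MeasurableSpace Ω] {P : Measure Ω} (D : ℕ → ℕ → Lp ℝ 2 P)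
    (tol : ℕ → ℝ) (K : ℕ) :
    ∀ᵐ ω ∂P, (∀ k ≤ K, ∀ i ≤ 2 ^ k, |treeIncrement D k i ω| ≤ tol k) →
      ∀ i ≤ 2 ^ K, |D K i ω| ≤ ∑ k ∈ Finset.range (K + 1), tol k := by
  have hae : ∀ᵐ ω ∂P, ∀ k i, treeIncrement D (k + 1) i ω = D (k + 1) i ω - D k (i / 2) ω := by
    rw [ae_all_iff]
    intro k
    rw [ae_all_iff]
    intro i
    filter_upwards [Lp.coeFn_sub (D (k + 1) i) (D k (i / 2))] with ω hω
    exact hω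
  filter_upwards [hae] with ω hω
  induction K with
  | zero =>
    intro h i hi
    simpa [treeIncrement] using h 0 le_rfl i hi
  | succ K ih =>
    intro h i hi
    have h1 := ih (fun k hk => h k (hk.trans (Nat.le_succ K))) (i / 2) (by
      rw [pow_succ] at hi
      omega)
    have h2 := h (K + 1) le_rfl i hi
    rw [hω] at h2
    rw [Finset.sum_range_succ]
    have h3 := abs_sub_abs_le_abs_sub (D (K + 1) i ω) (D K (i / 2) ω)
    linarith

lemma exists_two_pow_near {β ε : ℝ} (hβ : 0 < β) (hε0 : 0 < ε) (hε1 : ε ≤ 1) :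
    ∃ m : ℕ, (2 : ℝ) ^ m ≤ 2 * ε ^ (-(1 / β)) ∧ (2 : ℝ) ^ (-(β * m)) ≤ ε := by
  have hx : 1 ≤ ε ^ (-(1 / β)) :=
    Real.one_le_rpow_of_pos_of_le_one_of_nonpos hε0 hε1 (by
      have : 0 < 1 / β := by positivity
      linarith)
  obtain ⟨n, hn1, hn2⟩ := exists_nat_pow_near hx (one_lt_two (α := ℝ))
  refine ⟨n + 1, by rw [pow_succ]; linarith, ?_⟩
  have h1 : (2 : ℝ) ^ (-(β * ((n + 1 : ℕ) : ℝ))) = ((2 : ℝ) ^ (n + 1)) ^ (-β) := by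
    rw [← Real.rpow_natCast, ← Real.rpow_mul (by norm_num)]
    ring_nf
  rw [h1]
  calc ((2 : ℝ) ^ (n + 1)) ^ (-β) ≤ (ε ^ (-(1 / β))) ^ (-β) :=
        Real.rpow_le_rpow_of_nonpos (by positivity) hn2.le (by linarith)
    _ = ε := by
        rw [← Real.rpow_mul hε0.le]
        have : -(1 / β) * -β = 1 := by field_simp
        rw [this, Real.rpow_one]

/-- Scale comparison: the number of nodes at level `k` times the coding length at level `k` decays
geometrically away from the critical level `m`. -/
lemma two_pow_mul_coding_le {β : ℝ} (hβ : 0 < β) {p : ℕ} (hp : 3 ≤ β * p) (k m : ℕ) {ρ τ : ℝ}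
    (hρ : ρ = (2 : ℝ) ^ (-(β / 2))) (hτ : τ = ρ ^ (k - m) * (ρ⁻¹) ^ (3 * (m - k))) :
    (2 : ℝ) ^ k * (if τ ≤ 1 then τ ^ p else τ ^ (1 / (3 * β)))
      ≤ 2 ^ m * ((2 : ℝ) ^ (-(1 / 2) : ℝ)) ^ ((k - m) + (m - k)) := by
  have hρ0 : 0 < ρ := by rw [hρ]; positivity
  have hρ1 : ρ < 1 := by
    rw [hρ]
    exact Real.rpow_lt_one_of_one_lt_of_neg (by norm_num) (by linarith)
  rcases le_total m k with h | h
  · obtain ⟨j, rfl⟩ := Nat.exists_eq_add_of_le h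
    have e1 : m + j - m = j := by omega
    have e2 : m - (m + j) = 0 := by omega
    rw [e1, e2] at hτ
    rw [e1, e2]
    simp only [mul_zero, pow_zero, mul_one] at hτ
    rw [if_pos (hτ ▸ pow_le_one₀ hρ0.le hρ1.le), hτ, add_zero, pow_add, mul_assoc, ← pow_mul,
      mul_comm j p, pow_mul, ← mul_pow]
    gcongr
    rw [hρ, ← Real.rpow_natCast, ← Real.rpow_mul (by norm_num)]
    nth_rewrite 1 [← Real.rpow_one 2]
    rw [← Real.rpow_add (by norm_num)]
    exact Real.rpow_le_rpow_of_exponent_le (by norm_num) (by linarith)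
  · obtain ⟨j, rfl⟩ := Nat.exists_eq_add_of_le h
    have e1 : k + j - k = j := by omega
    have e2 : k - (k + j) = 0 := by omega
    rw [e1, e2] at hτ
    rw [e1, e2, zero_add]
    simp only [pow_zero, one_mul] at hτ
    have hτe : τ = (2 : ℝ) ^ (3 * β / 2 * j) := by
      rw [hτ, hρ, ← Real.rpow_neg (by norm_num), ← Real.rpow_natCast,
        ← Real.rpow_mul (by norm_num)]
      congr 1
      push_cast
      ring
    have key : τ ^ (1 / (3 * β)) = 2 ^ j * ((2 : ℝ) ^ (-(1 / 2) : ℝ)) ^ j := by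
      rw [hτe, ← Real.rpow_mul (by norm_num), ← Real.rpow_natCast, ← Real.rpow_natCast,
        ← Real.rpow_mul (by norm_num), ← Real.rpow_add (by norm_num)]
      congr 1
      field_simp
      ring
    rw [pow_add, mul_assoc, ← key]
    gcongr
    split_ifs with h1
    · have : (1 : ℝ) ≤ τ := by
        rw [hτe]
        exact Real.one_le_rpow (by norm_num) (by positivity)
      rw [le_antisymm h1 this]
      simp
    · exact le_rfl

/-- Small-ball lower bound for a Gaussian family on a dyadic tree with geometrically decaying
increments, uniformly in the depth of the tree. -/
lemma IsGaussianSubspace.exists_tree_small_ball {Ω : Type*} [MeasurableSpace Ω] {P : Measure Ω}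
    [IsProbabilityMeasure P] {H : Submodule ℝ (Lp ℝ 2 P)} (hH : IsGaussianSubspace P H)
    (D : ℕ → ℕ → Lp ℝ 2 P) (hD : ∀ k i, i ≤ 2 ^ k → D k i ∈ H) {β C : ℝ} (hβ : 0 < β) (hC : 0 ≤ C)
    (hinc : ∀ k i, i ≤ 2 ^ k → ‖treeIncrement D k i‖ ≤ C * (2 : ℝ) ^ (-(β * k))) :
    ∃ A : ℝ, 0 < A ∧ ∀ ε : ℝ, 0 < ε → ε ≤ 1 → ∀ K : ℕ,
      Real.exp (-(A * ε ^ (-(1 / β)))) ≤ P.real {ω | ∀ i ≤ 2 ^ K, |D K i ω| ≤ ε} := by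
  set ρ : ℝ := (2 : ℝ) ^ (-(β / 2)) with hρ
  have hρ0 : 0 < ρ := by positivity
  have hρ1 : ρ < 1 := Real.rpow_lt_one_of_one_lt_of_neg (by norm_num) (by linarith)
  set r : ℝ := (2 : ℝ) ^ (-(1 / 2) : ℝ) with hr
  have hr0 : 0 < r := by positivity
  have hr1 : r < 1 := Real.rpow_lt_one_of_one_lt_of_neg (by norm_num) (by norm_num)
  obtain ⟨p, hp⟩ := exists_nat_ge (3 / β)
  have hp3 : 3 ≤ β * p := by
    rw [div_le_iff₀ hβ] at hp
    linarith
  have hp0 : p ≠ 0 := by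
    rintro rfl
    norm_num at hp3
  set κ : ℝ := (1 - ρ) / 2 with hκ
  have hκ0 : 0 < κ := by rw [hκ]; linarith
  obtain ⟨A, hA, hcode⟩ := exists_coding_length_le (C := C / κ) (by positivity) hp0
    (θ := 1 / (3 * β)) (by positivity)
  have hS : 0 < 2 / (1 - r) := div_pos two_pos (by linarith)
  refine ⟨Real.log 4 + 8 * A * (2 / (1 - r)), by
    have := Real.log_pos (show (1 : ℝ) < 4 by norm_num)
    positivity, ?_⟩
  intro ε hε0 hε1 K
  obtain ⟨m, hm1, hm2⟩ := exists_two_pow_near hβ hε0 hε1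
  set τ : ℕ → ℝ := fun k => ρ ^ (k - m) * (ρ⁻¹) ^ (3 * (m - k)) with hτ
  set tol : ℕ → ℝ := fun k => κ * ε * ρ ^ ((k - m) + (m - k)) with htol
  have hτ0 : ∀ k, 0 < τ k := fun k => by positivity
  have htol0 : ∀ k, 0 < tol k := fun k => by positivity
  choose l hl hlcode using fun k => hcode (τ k) (hτ0 k)
  have hscale : ∀ k : ℕ, (2 : ℝ) ^ (-(β * k)) ≤ tol k * (τ k / κ) := by
    intro k
    have e0 : ∀ n : ℕ, (2 : ℝ) ^ (-(β * n)) = ρ ^ (2 * n) := fun n => by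
      rw [hρ, ← Real.rpow_natCast, ← Real.rpow_mul (by norm_num)]
      congr 1
      push_cast
      ring
    have e1 : tol k * (τ k / κ)
        = ε * (ρ ^ ((k - m) + (m - k)) * (ρ ^ (k - m) * (ρ⁻¹) ^ (3 * (m - k)))) := by
      simp only [htol, hτ]
      field_simp
    have e2 : ρ ^ (2 * k) = ρ ^ (2 * m) *
        (ρ ^ ((k - m) + (m - k)) * (ρ ^ (k - m) * (ρ⁻¹) ^ (3 * (m - k)))) := by
      rw [inv_pow]
      field_simp
      simp only [← pow_add]
      congr 1
      omega
    rw [e0] at hm2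
    rw [e0, e1, e2]
    gcongr
  have htree : ∀ k i, i ≤ 2 ^ k → treeIncrement D k i ∈ H := by
    intro k i hi
    cases k with
    | zero => exact hD 0 i hi
    | succ k =>
      refine H.sub_mem (hD (k + 1) i hi) (hD k (i / 2) ?_)
      rw [pow_succ] at hi
      omega
  have hLpos : 0 < 2 * A * (2 / (1 - r)) * 2 ^ m := by positivity
  have key := hH.real_forall_abs_le_one_ge
    (ι := Σ k : Fin (K + 1), Fin (2 ^ (k : ℕ) + 1))
    (fun q => (tol q.1)⁻¹ • treeIncrement D q.1 q.2) (fun q => H.smul_mem _ ?_)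
    (fun q => l q.1) (fun q => hl _) hLpos ?_
  · have hexp : Real.exp (-((Real.log 4 + 8 * A * (2 / (1 - r))) * ε ^ (-(1 / β))))
        ≤ 1 / 4 * Real.exp (-(2 * (2 * A * (2 / (1 - r)) * 2 ^ m))) := by
      have h4 : (1 / 4 : ℝ) = Real.exp (-Real.log 4) := by
        rw [Real.exp_neg, Real.exp_log (by norm_num)]
        norm_num
      rw [h4, ← Real.exp_add]
      apply Real.exp_le_exp.2
      have hx : 1 ≤ ε ^ (-(1 / β)) :=
        Real.one_le_rpow_of_pos_of_le_one_of_nonpos hε0 hε1 (by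
          have : 0 < 1 / β := by positivity
          linarith)
      have hlog4 := Real.log_pos (show (1 : ℝ) < 4 by norm_num)
      have h5 : 4 * A * (2 / (1 - r)) * 2 ^ m
          ≤ 4 * A * (2 / (1 - r)) * (2 * ε ^ (-(1 / β))) := by gcongr
      nlinarith
    refine (hexp.trans key).trans ?_
    refine ENNReal.toReal_mono (measure_ne_top _ _) (measure_mono_ae ?_)
    have hsm : ∀ᵐ ω ∂P, ∀ k i, ((tol k)⁻¹ • treeIncrement D k i : Lp ℝ 2 P) ω
        = (tol k)⁻¹ * treeIncrement D k i ω := by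
      rw [ae_all_iff]
      intro k
      rw [ae_all_iff]
      intro i
      filter_upwards [Lp.coeFn_smul (tol k)⁻¹ (treeIncrement D k i)] with ω hω
      rw [hω]; rfl
    filter_upwards [hsm, abs_tree_le_sum D tol K] with ω h1 h2 h3
    intro i hi
    refine (h2 (fun k hk i hi => ?_) i hi).trans ?_
    · have h4 := h3 ⟨⟨k, Nat.lt_succ_of_le hk⟩, ⟨i, Nat.lt_succ_of_le hi⟩⟩
      simp only [h1] at h4
      rw [abs_mul, abs_of_pos (inv_pos.2 (htol0 k)), inv_mul_le_iff₀ (htol0 k), mul_one] at h4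
      exact h4
    · simp only [htol]
      rw [← Finset.mul_sum]
      have := sum_range_pow_dist_le hρ0.le hρ1 m (K + 1)
      calc κ * ε * ∑ k ∈ Finset.range (K + 1), ρ ^ ((k - m) + (m - k))
          ≤ κ * ε * (2 / (1 - ρ)) := by gcongr
        _ = ε := by
            have : 1 - ρ ≠ 0 := by linarith
            rw [hκ]
            field_simp
  · exact htree q.1 q.2 (Nat.lt_succ_iff.1 q.2.2)
  · have hterm : ∀ k i : ℕ, i ≤ 2 ^ k →
        Real.log (1 + 2 / l k) + l k * ∫ ω, |(round (((tol k)⁻¹ • treeIncrement D k i :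
          Lp ℝ 2 P) ω) : ℝ)| ∂P ≤ A * (if τ k ≤ 1 then τ k ^ p else τ k ^ (1 / (3 * β))) := by
      intro k i hi
      refine hlcode k P _ (hH _ (H.smul_mem _ (htree k i hi))) ?_
      rw [norm_smul, norm_inv, Real.norm_of_nonneg (htol0 k).le, inv_mul_le_iff₀ (htol0 k)]
      calc ‖treeIncrement D k i‖ ≤ C * (2 : ℝ) ^ (-(β * k)) := hinc k i hi
        _ ≤ C * (tol k * (τ k / κ)) := by gcongr; exact hscale k
        _ = tol k * (C / κ * τ k) := by ring
    rw [Fintype.sum_sigma]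
    have hlevel : ∀ k : ℕ, 2 ^ k * (A * (if τ k ≤ 1 then τ k ^ p else τ k ^ (1 / (3 * β))))
        ≤ A * 2 ^ m * r ^ ((k - m) + (m - k)) := by
      intro k
      have := mul_le_mul_of_nonneg_left
        (two_pow_mul_coding_le hβ hp3 k m hρ (τ := τ k) rfl) hA.le
      linarith
    have hnn : ∀ k : ℕ, 0 ≤ A * (if τ k ≤ 1 then τ k ^ p else τ k ^ (1 / (3 * β))) := by
      intro k
      have := hτ0 k
      split_ifs <;> positivity
    calc _ ≤ ∑ k : Fin (K + 1), 2 * (A * 2 ^ m * r ^ (((k : ℕ) - m) + (m - k))) := by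
          refine Finset.sum_le_sum fun k _ => ?_
          refine (Finset.sum_le_card_nsmul _ _ _ fun (i : Fin (2 ^ (k : ℕ) + 1)) _ =>
            hterm k i (Nat.lt_succ_iff.1 i.2)).trans ?_
          rw [Finset.card_univ, Fintype.card_fin, nsmul_eq_mul]
          push_cast
          have h1 := hlevel k
          have h2 := hnn k
          have h3 : (1 : ℝ) ≤ 2 ^ (k : ℕ) := one_le_pow₀ (by norm_num)
          nlinarith
      _ = 2 * (A * 2 ^ m) * ∑ k ∈ Finset.range (K + 1), r ^ ((k - m) + (m - k)) := by
          rw [Fin.sum_univ_eq_sum_range (fun k => 2 * (A * 2 ^ m * r ^ ((k - m) + (m - k)))),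
            Finset.mul_sum]
          simp only [mul_assoc]
      _ ≤ 2 * (A * 2 ^ m) * (2 / (1 - r)) := by
          gcongr
          exact sum_range_pow_dist_le hr0.le hr1 m (K + 1)
      _ = _ := by ring

/-- A centered Gaussian process on a set `T`, viewed as a curve in `L²`. -/
lemma exists_Lp_curve {Ω : Type*} [MeasurableSpace Ω] {P : Measure Ω} [IsProbabilityMeasure P]
    {T : Set ℝ} {X : ℝ → Ω → ℝ}
    (hGauss : ∀ (n : ℕ) (t : Fin n → ℝ), (∀ i, t i ∈ T) → ∀ c : Fin n → ℝ,
      ∃ v : NNReal, Measure.map (fun ω => ∑ i, c i * X (t i) ω) P = gaussianReal 0 v) :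
    ∃ F : ℝ → Lp ℝ 2 P, (∀ t ∈ T, F t =ᵐ[P] X t) ∧
      IsGaussianSubspace P (Submodule.span ℝ (F '' T)) := by
  classical
  have hmem : ∀ t ∈ T, MemLp (X t) 2 P := by
    intro t ht
    obtain ⟨v, hv⟩ := hGauss 1 (fun _ => t) (fun _ => ht) (fun _ => 1)
    simp only [Finset.univ_unique, Finset.sum_singleton, one_mul] at hv
    change P.map (X t) = _ at hv
    have hm : AEMeasurable (X t) P := by
      refine AEMeasurable.of_map_ne_zero ?_
      rw [hv]
      exact IsProbabilityMeasure.ne_zero _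
    have := memLp_id_gaussianReal (μ := 0) (v := v) 2
    rw [← hv, memLp_map_measure_iff (by fun_prop) hm] at this
    exact this
  set F : ℝ → Lp ℝ 2 P := fun t => if ht : t ∈ T then (hmem t ht).toLp else 0 with hF
  have hFX : ∀ t ∈ T, F t =ᵐ[P] X t := by
    intro t ht
    simp only [hF, dif_pos ht]
    exact MemLp.coeFn_toLp _
  refine ⟨F, hFX, fun f hf => ?_⟩
  obtain ⟨n, c, g, hg⟩ := Submodule.mem_span_set'.1 hf
  choose t ht hgt using fun i => (g i).2
  obtain ⟨v, hv⟩ := hGauss n t ht c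
  refine map_eq_gaussianReal_norm_sq (v := v) ?_
  rw [← hv]
  refine Measure.map_congr ?_
  rw [← hg]
  have hall : ∀ᵐ ω ∂P, ∀ i, (g i : Lp ℝ 2 P) ω = X (t i) ω := by
    rw [ae_all_iff]
    intro i
    rw [← hgt i]
    exact hFX _ (ht i)
  filter_upwards [coeFn_sum_smul c (fun i => (g i : Lp ℝ 2 P)), hall] with ω h1 h2
  rw [h1]
  simp only [h2]

lemma restrict_eq_self_of_compl_null {ν : Measure ℝ} {T : Set ℝ} (h : ν Tᶜ = 0) :
    ν.restrict T = ν :=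
  Measure.restrict_eq_self_of_ae_mem (mem_ae_iff.2 h)

lemma ContinuousOn.integrable_of_compl_null {E : Type*} [NormedAddCommGroup E]
    {ν : Measure ℝ} [IsFiniteMeasure ν] {a b : ℝ} {F : ℝ → E} (hF : ContinuousOn F (Icc a b))
    (h : ν (Icc a b)ᶜ = 0) : Integrable F ν := by
  have := hF.integrableOn_compact (μ := ν) isCompact_Icc
  rwa [IntegrableOn, restrict_eq_self_of_compl_null h] at this

lemma kernelEnergy_eq_norm_sq {E : Type*} [NormedAddCommGroup E] [InnerProductSpace ℝ E]
    [CompleteSpace E] {ν : Measure ℝ} [IsFiniteMeasure ν] {a b : ℝ} {F : ℝ → E}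
    (hF : ContinuousOn F (Icc a b)) {R : ℝ → ℝ → ℝ}
    (hR : ∀ s ∈ Icc a b, ∀ t ∈ Icc a b, R s t = inner ℝ (F s) (F t)) (h : ν (Icc a b)ᶜ = 0) :
    kernelEnergy R ν = ‖∫ t, F t ∂ν‖ ^ 2 := by
  have hae : ∀ᵐ t ∂ν, t ∈ Icc a b := mem_ae_iff.2 h
  have hint := hF.integrable_of_compl_null h
  have h1 : ∀ᵐ s ∂ν, ∫ t, R s t ∂ν = inner ℝ (∫ t, F t ∂ν) (F s) := by
    filter_upwards [hae] with s hs
    rw [real_inner_comm, ← integral_inner hint]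
    refine integral_congr_ae ?_
    filter_upwards [hae] with t ht
    exact hR s hs t ht
  rw [kernelEnergy, integral_congr_ae h1, integral_inner hint, real_inner_self_eq_norm_sq]

/-- The barycenter of an optimal measure of full support has constant covariance with the curve. -/
lemma inner_integral_eq_of_optimal {E : Type*} [NormedAddCommGroup E] [InnerProductSpace ℝ E]
    [CompleteSpace E] {ν : Measure ℝ} [IsProbabilityMeasure ν] {a b : ℝ} {F : ℝ → E}
    (hF : ContinuousOn F (Icc a b)) {R : ℝ → ℝ → ℝ}
    (hR : ∀ s ∈ Icc a b, ∀ t ∈ Icc a b, R s t = inner ℝ (F s) (F t)) (h : ν (Icc a b)ᶜ = 0)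
    (hopt : ∀ μ : Measure ℝ, IsProbabilityMeasure μ → μ (Icc a b)ᶜ = 0 →
      kernelEnergy R ν ≤ kernelEnergy R μ)
    (hfull : measSupport ν = Icc a b) {s : ℝ} (hs : s ∈ Icc a b) :
    inner ℝ (∫ t, F t ∂ν) (F s) = ‖∫ t, F t ∂ν‖ ^ 2 := by
  set Y := ∫ t, F t ∂ν with hY
  have hint := hF.integrable_of_compl_null h
  have hae : ∀ᵐ t ∂ν, t ∈ Icc a b := mem_ae_iff.2 h
  have hge : ∀ s ∈ Icc a b, 0 ≤ inner ℝ Y (F s) - ‖Y‖ ^ 2 := by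
    intro s hs
    have hvar : ∀ ε : ℝ, 0 < ε → ε ≤ 1 → ‖Y‖ ^ 2 ≤ ‖Y + ε • (F s - Y)‖ ^ 2 := by
      intro ε h0 h1
      set μ : Measure ℝ := ENNReal.ofReal (1 - ε) • ν + ENNReal.ofReal ε • Measure.dirac s with hμ
      have hμp : IsProbabilityMeasure μ := by
        constructor
        simp only [hμ, Measure.add_apply, Measure.smul_apply, measure_univ, smul_eq_mul, mul_one]
        rw [← ENNReal.ofReal_add (by linarith) h0.le]
        simp
      have hμs : μ (Icc a b)ᶜ = 0 := by
        simp [hμ, h, Measure.dirac_apply' _ measurableSet_Icc.compl, hs]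
      have e := hopt μ hμp hμs
      rw [kernelEnergy_eq_norm_sq hF hR h, kernelEnergy_eq_norm_sq hF hR hμs] at e
      have hi2 : Integrable F (Measure.dirac s) := hF.integrable_of_compl_null
        (by simp [Measure.dirac_apply' _ measurableSet_Icc.compl, hs])
      have e2 : ∫ t, F t ∂μ = Y + ε • (F s - Y) := by
        rw [hμ, integral_add_measure (hint.smul_measure ENNReal.ofReal_ne_top)
          (hi2.smul_measure ENNReal.ofReal_ne_top), integral_smul_measure, integral_smul_measure,
          integral_dirac, ENNReal.toReal_ofReal h0.le, ENNReal.toReal_ofReal (by linarith), ← hY]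
        module
      rwa [e2] at e
    by_contra! hneg
    set x := inner ℝ Y (F s) - ‖Y‖ ^ 2 with hx
    have hx' : inner ℝ Y (F s - Y) = x := by
      rw [inner_sub_right, real_inner_self_eq_norm_sq]
    set N := ‖F s - Y‖ ^ 2 with hN
    have hN0 : 0 ≤ N := by positivity
    set ε := min 1 (-x / (N + 1)) with hε
    have hε0 : 0 < ε := lt_min one_pos (div_pos (by linarith) (by linarith))
    have h2 := hvar ε hε0 (min_le_left _ _)
    rw [norm_add_sq_real, inner_smul_right, hx', norm_smul, mul_pow, Real.norm_of_nonneg hε0.le,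
      ← hN] at h2
    have h3 : ε * (N + 1) ≤ -x := by
      rw [← le_div_iff₀ (by linarith)]
      exact min_le_right _ _
    nlinarith
  have hcont : ContinuousOn (fun s => inner ℝ Y (F s) - ‖Y‖ ^ 2) (Icc a b) :=
    (continuousOn_const.inner hF).sub continuousOn_const
  have hzero : ∫ s, (inner ℝ Y (F s) - ‖Y‖ ^ 2) ∂ν = 0 := by
    rw [integral_sub (hint.const_inner Y) (integrable_const _), integral_inner hint, ← hY,
      real_inner_self_eq_norm_sq]
    simp
  have hae0 := (integral_eq_zero_iff_of_nonneg_ae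
    (f := fun s => inner ℝ Y (F s) - ‖Y‖ ^ 2) (hae.mono hge)
    (hcont.integrable_of_compl_null h)).1 hzero
  by_contra hne
  have hpos : 0 < inner ℝ Y (F s) - ‖Y‖ ^ 2 :=
    lt_of_le_of_ne (hge s hs) (fun h => hne (by linarith))
  have hev := (hcont s hs).eventually (lt_mem_nhds hpos)
  obtain ⟨U, hU, hsU, hUsub⟩ := mem_nhdsWithin.1 hev
  have hUpos : 0 < ν U := by
    have : s ∈ measSupport ν := hfull ▸ hs
    exact this U hU hsU
  refine hUpos.ne' (measure_eq_zero_iff_ae_notMem.2 ?_)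
  filter_upwards [hae, hae0] with t ht h0 htU
  have := hUsub ⟨htU, ht⟩
  simp only [Set.mem_ofPred_eq, Pi.zero_apply] at this h0
  linarith

lemma continuousOn_of_norm_sub_le_rpow {E : Type*} [NormedAddCommGroup E] {T : Set ℝ}
    {C β h0 : ℝ} (hβ : 0 < β) (hh0 : 0 < h0) {F : ℝ → E}
    (hF : ∀ s ∈ T, ∀ t ∈ T, |t - s| < h0 → ‖F t - F s‖ ≤ C * |t - s| ^ β) :
    ContinuousOn F T := by
  intro s hs
  rw [ContinuousWithinAt, tendsto_iff_norm_sub_tendsto_zero]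
  have hlim0 : Tendsto (fun t => C * |t - s| ^ β) (nhdsWithin s (T)) (nhds 0) := by
    have : Continuous fun t => C * |t - s| ^ β := by
      have : Continuous fun t : ℝ => |t - s| := by fun_prop
      exact continuous_const.mul (this.rpow_const fun _ => Or.inr hβ.le)
    have h := (this.tendsto s).mono_left (nhdsWithin_le_nhds (s := T))
    simpa [Real.zero_rpow hβ.ne'] using h
  refine squeeze_zero' (Eventually.of_forall fun _ => norm_nonneg _) ?_ hlim0
  have hnear : ∀ᶠ t in nhdsWithin s (T), |t - s| < h0 := by
    refine nhdsWithin_le_nhds ?_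
    filter_upwards [Metric.ball_mem_nhds s hh0] with t ht
    rwa [Metric.mem_ball, Real.dist_eq] at ht
  filter_upwards [hnear, self_mem_nhdsWithin] with t ht hts
  exact hF s hs t hts ht

/-- A local power bound on increments over a compact interval is a Hölder bound. -/
lemma exists_holder_bound {E : Type*} [NormedAddCommGroup E] {a b β c : ℝ} (hβ : 0 < β)
    (hc : 0 < c) {σ : ℝ → ℝ} (hσ : ∀ h : ℝ, 0 ≤ h → 0 ≤ σ h)
    (hlim : Tendsto (fun h : ℝ => h ^ (-β) * σ h) (nhdsWithin 0 (Ioi 0)) (nhds c))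
    {F : ℝ → E} (hF : ∀ s ∈ Icc a b, ∀ t ∈ Icc a b, ‖F t - F s‖ ^ 2 ≤ σ |t - s| ^ 2) :
    ∃ C : ℝ, 0 ≤ C ∧ ∀ s ∈ Icc a b, ∀ t ∈ Icc a b, ‖F t - F s‖ ≤ C * |t - s| ^ β := by
  have hev : ∀ᶠ h in nhdsWithin (0 : ℝ) (Ioi 0), h ^ (-β) * σ h < 2 * c :=
    hlim.eventually (gt_mem_nhds (by linarith))
  obtain ⟨h0, hh0, hsub⟩ := mem_nhdsGT_iff_exists_Ioo_subset.1 hev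
  have hh0 : 0 < h0 := hh0
  have hloc : ∀ s ∈ Icc a b, ∀ t ∈ Icc a b, |t - s| < h0 → ‖F t - F s‖ ≤ 2 * c * |t - s| ^ β := by
    intro s hs t ht hst
    rcases eq_or_ne t s with rfl | hne
    · simp [Real.zero_rpow hβ.ne']
    · have hpos : 0 < |t - s| := abs_pos.2 (sub_ne_zero.2 hne)
      have h1 : |t - s| ^ (-β) * σ |t - s| < 2 * c := hsub ⟨hpos, hst⟩
      have h2 : ‖F t - F s‖ ≤ σ |t - s| :=
        (pow_le_pow_iff_left₀ (norm_nonneg _) (hσ _ (abs_nonneg _)) two_ne_zero).1 (hF s hs t ht)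
      rw [Real.rpow_neg hpos.le, inv_mul_lt_iff₀ (by positivity)] at h1
      linarith
  have hcont := continuousOn_of_norm_sub_le_rpow hβ hh0 hloc
  obtain ⟨M, hM⟩ := isCompact_Icc.exists_bound_of_continuousOn hcont
  refine ⟨max (2 * c) (2 * M / h0 ^ β), le_max_of_le_left (by linarith), fun s hs t ht => ?_⟩
  rcases lt_or_ge |t - s| h0 with h | h
  · refine (hloc s hs t ht h).trans ?_
    gcongr
    exact le_max_left _ _
  · have hM0 : 0 ≤ M := (norm_nonneg _).trans (hM s hs)
    calc ‖F t - F s‖ ≤ ‖F t‖ + ‖F s‖ := norm_sub_le _ _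
      _ ≤ 2 * M / h0 ^ β * h0 ^ β := by
          rw [div_mul_cancel₀ _ (by positivity)]
          linarith [hM s hs, hM t ht]
      _ ≤ 2 * M / h0 ^ β * |t - s| ^ β := by gcongr
      _ ≤ _ := by gcongr; exact le_max_right _ _

/-- The `i`-th dyadic point of level `k` in `[a, b]`. -/
noncomputable def dyadicPoint (a b : ℝ) (k i : ℕ) : ℝ := a + (b - a) * (i / 2 ^ k)

lemma dyadicPoint_mem {a b : ℝ} (hab : a ≤ b) {k i : ℕ} (hi : i ≤ 2 ^ k) :
    dyadicPoint a b k i ∈ Icc a b := by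
  have h1 : (i : ℝ) / 2 ^ k ≤ 1 := by
    rw [div_le_one (by positivity)]
    exact_mod_cast hi
  have h0 : (0 : ℝ) ≤ (i : ℝ) / 2 ^ k := by positivity
  constructor <;> unfold dyadicPoint <;> nlinarith

lemma dyadicPoint_succ_two_mul (a b : ℝ) (k i : ℕ) :
    dyadicPoint a b (k + 1) (2 * i) = dyadicPoint a b k i := by
  unfold dyadicPoint
  rw [pow_succ]
  push_cast
  field_simp

lemma abs_dyadicPoint_sub_le {a b : ℝ} (hab : a ≤ b) (k i : ℕ) :
    |dyadicPoint a b (k + 1) i - dyadicPoint a b k (i / 2)|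
      ≤ (b - a) * (2 : ℝ) ^ (-((k + 1 : ℕ) : ℝ)) := by
  rw [← dyadicPoint_succ_two_mul a b k]
  have h : i = 2 * (i / 2) ∨ i = 2 * (i / 2) + 1 := by omega
  have hba : 0 ≤ b - a := by linarith
  unfold dyadicPoint
  have e : a + (b - a) * ((i : ℝ) / 2 ^ (k + 1))
        - (a + (b - a) * (((2 * (i / 2) : ℕ) : ℝ) / 2 ^ (k + 1)))
      = (b - a) * (((i : ℝ) - ((2 * (i / 2) : ℕ) : ℝ)) / 2 ^ (k + 1)) := by ring
  rw [e, abs_mul, abs_of_nonneg hba, Real.rpow_neg (by norm_num), Real.rpow_natCast, abs_div,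
    abs_of_pos (show (0 : ℝ) < 2 ^ (k + 1) by positivity), div_eq_mul_inv]
  refine mul_le_mul_of_nonneg_left (mul_le_of_le_one_left (by positivity) ?_) hba
  have h2 : (2 * (i / 2)) ≤ i := by omega
  have h3 : i - 2 * (i / 2) ≤ 1 := by omega
  rw [← Nat.cast_sub h2, Nat.abs_cast]
  exact_mod_cast h3

/-- A Hölder curve sampled at dyadic points has geometrically decaying tree increments. -/
lemma exists_norm_treeIncrement_le {E : Type*} [NormedAddCommGroup E] {a b β C : ℝ}
    (hab : a ≤ b) (hβ : 0 < β) (hC : 0 ≤ C) {Z : ℝ → E}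
    (hZ : ∀ s ∈ Icc a b, ∀ t ∈ Icc a b, ‖Z t - Z s‖ ≤ C * |t - s| ^ β) :
    ∃ B : ℝ, 0 ≤ B ∧ ∀ k i, i ≤ 2 ^ k →
      ‖treeIncrement (fun k i => Z (dyadicPoint a b k i)) k i‖ ≤ B * (2 : ℝ) ^ (-(β * k)) := by
  have hba : 0 ≤ b - a := by linarith
  have ha : a ∈ Icc a b := ⟨le_rfl, hab⟩
  refine ⟨‖Z a‖ + C * (b - a) ^ β, by positivity, fun k i hi => ?_⟩
  cases k with
  | zero =>
    have hm := dyadicPoint_mem hab hi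
    have h1 := hZ a ha _ hm
    have h2 : |dyadicPoint a b 0 i - a| ≤ b - a := by
      rw [abs_of_nonneg (by linarith [hm.1])]
      linarith [hm.2]
    have h3 : ‖Z (dyadicPoint a b 0 i)‖ ≤ ‖Z a‖ + ‖Z (dyadicPoint a b 0 i) - Z a‖ := by
      have := norm_add_le (Z a) (Z (dyadicPoint a b 0 i) - Z a)
      rwa [add_sub_cancel] at this
    have h4 : C * |dyadicPoint a b 0 i - a| ^ β ≤ C * (b - a) ^ β := by gcongr
    simp only [treeIncrement, CharP.cast_eq_zero, mul_zero, neg_zero, Real.rpow_zero, mul_one]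
    linarith
  | succ k =>
    have hm := dyadicPoint_mem hab hi
    have hm2 : dyadicPoint a b k (i / 2) ∈ Icc a b := dyadicPoint_mem hab (by
      rw [pow_succ] at hi
      omega)
    calc ‖Z (dyadicPoint a b (k + 1) i) - Z (dyadicPoint a b k (i / 2))‖
        ≤ C * |dyadicPoint a b (k + 1) i - dyadicPoint a b k (i / 2)| ^ β := hZ _ hm2 _ hm
      _ ≤ C * ((b - a) * (2 : ℝ) ^ (-((k + 1 : ℕ) : ℝ))) ^ β := by
          gcongr
          exact abs_dyadicPoint_sub_le hab k i
      _ = C * (b - a) ^ β * (2 : ℝ) ^ (-(β * (k + 1 : ℕ))) := by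
          rw [Real.mul_rpow hba (by positivity), ← Real.rpow_mul (by norm_num)]
          ring_nf
      _ ≤ _ := by
          gcongr
          linarith [norm_nonneg (Z a)]

/-- A lower bound for the mass of a short interval under a centered Gaussian law. -/
lemma gaussianReal_Icc_real_ge {v : NNReal} (hv : v ≠ 0) {x ε : ℝ} (hx : 0 ≤ x) (hε : 0 ≤ ε) :
    ε * (Real.sqrt (2 * Real.pi * v))⁻¹ * Real.exp (-((x + ε) ^ 2 / (2 * v)))
      ≤ (gaussianReal 0 v).real (Icc x (x + ε)) := by
  rw [measureReal_def, gaussianReal_apply_eq_integral _ hv, ENNReal.toReal_ofReal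
    (setIntegral_nonneg measurableSet_Icc fun y _ => gaussianPDFReal_nonneg _ _ _)]
  have hvol : volume.real (Icc x (x + ε)) = ε := by
    rw [Real.volume_real_Icc_of_le (by linarith)]
    ring
  have h := setIntegral_mono_on (μ := volume) (s := Icc x (x + ε))
    (f := fun _ => (Real.sqrt (2 * Real.pi * v))⁻¹ * Real.exp (-((x + ε) ^ 2 / (2 * v))))
    (g := gaussianPDFReal 0 v) (integrableOn_const (by simp))
    (integrable_gaussianPDFReal 0 v).integrableOn
    measurableSet_Icc (fun y hy => by
      rw [gaussianPDFReal, sub_zero, neg_div]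
      gcongr
      · exact hx.trans hy.1
      · exact hy.2)
  rw [setIntegral_const, hvol, smul_eq_mul] at h
  linarith

/-- Values of a continuous function at dyadic points control it on the whole interval. -/
lemma ContinuousOn.le_of_le_dyadicPoint {a b : ℝ} (hab : a < b) {f : ℝ → ℝ}
    (hf : ContinuousOn f (Icc a b)) {x : ℝ}
    (h : ∀ K i, i ≤ 2 ^ K → x ≤ f (dyadicPoint a b K i)) {t : ℝ} (ht : t ∈ Icc a b) :
    x ≤ f t := by
  have hba : 0 < b - a := by linarith
  set θ := (t - a) / (b - a) with hθ
  have hθ0 : 0 ≤ θ := div_nonneg (by linarith [ht.1]) hba.le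
  have hθ1 : θ ≤ 1 := (div_le_one hba).2 (by linarith [ht.2])
  set i : ℕ → ℕ := fun K => ⌊θ * 2 ^ K⌋₊ with hi
  have hile : ∀ K, i K ≤ 2 ^ K := fun K => Nat.floor_le_of_le (by
    push_cast
    exact mul_le_of_le_one_left (by positivity) hθ1)
  have hpow : Tendsto (fun K : ℕ => (2 : ℝ) ^ K) atTop atTop :=
    tendsto_pow_atTop_atTop_of_one_lt one_lt_two
  have h1 : Tendsto (fun K => (i K : ℝ) / 2 ^ K) atTop (nhds θ) :=
    (tendsto_nat_floor_mul_div_atTop hθ0).comp hpow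
  have h2 : Tendsto (fun K => dyadicPoint a b K (i K)) atTop (nhds t) := by
    have := (h1.const_mul (b - a)).const_add a
    have e : a + (b - a) * θ = t := by
      rw [hθ, mul_div_cancel₀ _ hba.ne']
      ring
    rwa [e] at this
  have h3 : Tendsto (fun K => dyadicPoint a b K (i K)) atTop (nhdsWithin t (Icc a b)) :=
    tendsto_nhdsWithin_iff.2 ⟨h2, Eventually.of_forall fun K => dyadicPoint_mem hab.le (hile K)⟩
  exact ge_of_tendsto' ((hf t ht).tendsto.comp h3) fun K => h K _ (hile K)

/-- If a continuous process is positive with positive probability, then its barycenters do not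
vanish. -/
lemma integral_ne_zero_of_pos {Ω : Type*} [MeasurableSpace Ω] {P : Measure Ω}
    [IsProbabilityMeasure P] {a b : ℝ} (hab : a < b) {X : ℝ → Ω → ℝ}
    (hpath : ∀ ω, ContinuousOn (fun t => X t ω) (Icc a b))
    (hpos : 0 < P {ω | ∀ t ∈ Icc a b, 0 < X t ω}) {F : ℝ → Lp ℝ 2 P}
    (hFX : ∀ t ∈ Icc a b, F t =ᵐ[P] X t) (hF : ContinuousOn F (Icc a b)) {ν : Measure ℝ}
    [IsProbabilityMeasure ν] (hν : ν (Icc a b)ᶜ = 0) : ∫ t, F t ∂ν ≠ 0 := by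
  intro hY
  have hX : ∀ t ∈ Icc a b, AEMeasurable (X t) P := fun t ht =>
    (Lp_two_aemeasurable (F t)).congr (hFX t ht)
  set A : Set Ω := {ω | ∀ K i, i ≤ 2 ^ K → 0 < X (dyadicPoint a b K i) ω} with hA
  have hAm : NullMeasurableSet A P := by
    simp only [hA, Set.ofPred_forall]
    refine .iInter fun K => .iInter fun i => .iInter fun hi => ?_
    exact nullMeasurableSet_lt aemeasurable_const (hX _ (dyadicPoint_mem hab.le hi))
  have hAnn : ∀ ω ∈ A, ∀ t ∈ Icc a b, 0 ≤ X t ω := fun ω hω t ht =>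
    (hpath ω).le_of_le_dyadicPoint hab (fun K i hi => (hω K i hi).le) ht
  obtain ⟨B, hBA, hB, hBae⟩ := hAm.exists_measurable_subset_ae_eq
  have hint := hF.integrable_of_compl_null hν
  set g : Lp ℝ 2 P := indicatorConstLp 2 hB (measure_ne_top P B) (1 : ℝ) with hg
  have hgF : ∀ t ∈ Icc a b, inner ℝ g (F t) = ∫ ω in B, X t ω ∂P := fun t ht => by
    rw [hg, L2.inner_indicatorConstLp_one]
    exact integral_congr_ae (ae_restrict_of_ae (hFX t ht))
  have hae : ∀ᵐ t ∂ν, t ∈ Icc a b := mem_ae_iff.2 hν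
  have hnn : ∀ t ∈ Icc a b, 0 ≤ᵐ[P.restrict B] X t := fun t ht =>
    (ae_restrict_iff' hB).2 (ae_of_all _ fun ω hω => hAnn ω (hBA hω) t ht)
  have h0 : ∫ t, inner ℝ g (F t) ∂ν = 0 := by
    rw [integral_inner hint, hY, inner_zero_right]
  have hz := (integral_eq_zero_iff_of_nonneg_ae (hae.mono fun t ht => by
    rw [Pi.zero_apply, hgF t ht]
    exact integral_nonneg_of_ae (hnn t ht)) (hint.const_inner g)).1 h0
  obtain ⟨t, ht, htz⟩ := (hae.and hz).exists
  have htz : inner ℝ g (F t) = 0 := htz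
  rw [hgF t ht] at htz
  have hXint : Integrable (X t) P :=
    ((Lp.memLp (F t)).integrable (by norm_num)).congr (hFX t ht)
  have hXz := (integral_eq_zero_iff_of_nonneg_ae (hnn t ht) hXint.integrableOn).1 htz
  rw [EventuallyEq, ae_restrict_iff' hB] at hXz
  refine hpos.ne' (measure_eq_zero_iff_ae_notMem.2 ?_)
  filter_upwards [hXz, hBae.mem_iff] with ω h1 h2 h3
  have hωA : ω ∈ A := fun K i hi => h3 _ (dyadicPoint_mem hab.le hi)
  exact (h3 t ht).ne' (h1 (h2.2 hωA))

/-- Lower bound for the probability of a high minimum, from an independent barycenter and a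
small-ball estimate on the dyadic skeletons. -/
lemma IsGaussianSubspace.real_forall_lt_ge {Ω : Type*} [MeasurableSpace Ω] {P : Measure Ω}
    [IsProbabilityMeasure P] {a b : ℝ} (hab : a < b) {X : ℝ → Ω → ℝ}
    (hpath : ∀ ω, ContinuousOn (fun t => X t ω) (Icc a b)) {F : ℝ → Lp ℝ 2 P}
    (hFX : ∀ t ∈ Icc a b, F t =ᵐ[P] X t) {H : Submodule ℝ (Lp ℝ 2 P)}
    (hH : IsGaussianSubspace P H) {Y : Lp ℝ 2 P} (hY : Y ∈ H) (hFH : ∀ t ∈ Icc a b, F t ∈ H)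
    (horth : ∀ t ∈ Icc a b, inner ℝ Y (F t - Y) = 0) {u ε η : ℝ} (hε : 0 < ε)
    (hη : ∀ K : ℕ, η ≤ P.real {ω | ∀ i ≤ 2 ^ K, |(F (dyadicPoint a b K i) - Y) ω| ≤ ε}) :
    P.real {ω | u + 2 * ε ≤ Y ω} * η ≤ P.real {ω | ∀ t ∈ Icc a b, u < X t ω} := by
  have hX : ∀ t ∈ Icc a b, AEMeasurable (X t) P := fun t ht =>
    (Lp_two_aemeasurable (F t)).congr (hFX t ht)
  set G : ℕ → Set Ω := fun K => {ω | ∀ i ≤ 2 ^ K, u + ε ≤ X (dyadicPoint a b K i) ω} with hG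
  have hGm : ∀ K, NullMeasurableSet (G K) P := fun K => by
    simp only [hG, Set.ofPred_forall]
    refine .iInter fun i => .iInter fun hi => ?_
    exact nullMeasurableSet_le aemeasurable_const (hX _ (dyadicPoint_mem hab.le hi))
  have hGanti : Antitone G := antitone_nat_of_succ_le fun K ω hω i hi => by
    rw [← dyadicPoint_succ_two_mul]
    exact hω (2 * i) (by rw [pow_succ]; omega)
  have hGge : ∀ K, P.real {ω | u + 2 * ε ≤ Y ω} * η ≤ P.real (G K) := by
    intro K
    have hind := hH.indepFun Y hY (fun i : Fin (2 ^ K + 1) => F (dyadicPoint a b K i) - Y)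
      (fun i => H.sub_mem (hFH _ (dyadicPoint_mem hab.le (Nat.lt_succ_iff.1 i.2))) hY)
      (fun i => horth _ (dyadicPoint_mem hab.le (Nat.lt_succ_iff.1 i.2)))
    have hS : MeasurableSet {y : Unit → ℝ | u + 2 * ε ≤ y ()} :=
      measurableSet_le measurable_const (measurable_pi_apply _)
    have hT : MeasurableSet {z : Fin (2 ^ K + 1) → ℝ | ∀ i, |z i| ≤ ε} := by
      simp only [Set.ofPred_forall]
      exact .iInter fun i => measurableSet_le (by fun_prop) measurable_const
    have hmul := hind.measure_inter_preimage_eq_mul _ _ hS hT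
    have hsm : {ω | ∀ i ≤ 2 ^ K, |(F (dyadicPoint a b K i) - Y) ω| ≤ ε}
        = (fun ω (i : Fin (2 ^ K + 1)) => (F (dyadicPoint a b K i) - Y) ω) ⁻¹'
          {z | ∀ i, |z i| ≤ ε} := by
      ext ω
      exact ⟨fun h i => h i (Nat.lt_succ_iff.1 i.2), fun h i hi => h ⟨i, Nat.lt_succ_iff.2 hi⟩⟩
    have h1 := hη K
    rw [hsm] at h1
    have hmul' := congrArg ENNReal.toReal hmul
    rw [ENNReal.toReal_mul] at hmul'
    refine (mul_le_mul_of_nonneg_left h1 measureReal_nonneg).trans (hmul'.symm.le.trans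
      (ENNReal.toReal_mono (measure_ne_top _ _) (measure_mono_ae ?_)))
    have hae : ∀ᵐ ω ∂P, ∀ i ≤ 2 ^ K, (F (dyadicPoint a b K i) - Y) ω
        = X (dyadicPoint a b K i) ω - Y ω := by
      rw [ae_all_iff]
      intro i
      rw [ae_all_iff]
      intro hi
      filter_upwards [Lp.coeFn_sub (F (dyadicPoint a b K i)) Y,
        hFX _ (dyadicPoint_mem hab.le hi)] with ω h1 h2
      rw [h1, Pi.sub_apply, h2]
    filter_upwards [hae] with ω hω h i hi
    have h2 := h.2 ⟨i, Nat.lt_succ_iff.2 hi⟩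
    have h3 : u + 2 * ε ≤ Y ω := h.1
    simp only [hω i hi] at h2
    linarith [(abs_le.1 h2).1]
  have hlim := tendsto_measure_iInter_atTop hGm hGanti ⟨0, measure_ne_top P _⟩
  have hlim' : Tendsto (fun K => P.real (G K)) atTop (nhds (P.real (⋂ K, G K))) :=
    (ENNReal.tendsto_toReal (measure_ne_top _ _)).comp hlim
  refine (ge_of_tendsto' hlim' hGge).trans (measureReal_mono fun ω hω t ht => ?_)
  have h := (hpath ω).le_of_le_dyadicPoint hab (x := u + ε)
    (fun K i hi => Set.mem_iInter.1 hω K i hi) ht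
  exact (lt_add_of_pos_right u hε).trans_le h

/-- Optimization of the scale `ε` as a power of the level `u`. -/
lemma rpow_mul_log_add_ge {p : ℝ → ℝ} {v A β : ℝ} (hv : 0 < v) (hβ : 0 < β)
    (hp : ∀ u ε : ℝ, 0 < u → 0 < ε → ε ≤ 1 →
      ε * (Real.sqrt (2 * Real.pi * v))⁻¹ * Real.exp (-((u + 3 * ε) ^ 2 / (2 * v)))
        * Real.exp (-(A * ε ^ (-(1 / β)))) ≤ p u) {u : ℝ} (hu : 1 ≤ u) :
    -(β + |Real.log (Real.sqrt (2 * Real.pi * v))| + 15 / (2 * v) + A)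
      ≤ u ^ (-(1 / (β + 1))) * (Real.log (p u) + u ^ 2 / (2 * v)) := by
  have hu0 : 0 < u := by linarith
  have hβ1 : β + 1 ≠ 0 := by positivity
  obtain ⟨w, hw, hwu⟩ : ∃ w : ℝ, 1 ≤ w ∧ w = u ^ (1 / (β + 1)) :=
    ⟨_, Real.one_le_rpow hu (by positivity), rfl⟩
  have hw0 : 0 < w := by linarith
  set ε := w ^ (-β) with hε
  have hε0 : 0 < ε := by positivity
  have hε1 : ε ≤ 1 := Real.rpow_le_one_of_one_le_of_nonpos hw (by linarith)
  have huw : u = w ^ (β + 1) := by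
    rw [hwu, ← Real.rpow_mul hu0.le]
    simp [hβ1]
  have huε : u * ε = w := by
    rw [huw, hε, ← Real.rpow_add hw0]
    simp
  have hεw : ε ^ (-(1 / β)) = w := by
    rw [hε, ← Real.rpow_mul hw0.le]
    have : -β * -(1 / β) = 1 := by field_simp
    rw [this, Real.rpow_one]
  have hs : 0 < Real.sqrt (2 * Real.pi * v) := Real.sqrt_pos.2 (by positivity)
  have hlog := Real.log_le_log (by positivity) (hp u ε hu0 hε0 hε1)
  rw [Real.log_mul (by positivity) (by positivity), Real.log_mul (by positivity) (by positivity),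
    Real.log_mul (by positivity) (by positivity), Real.log_exp, Real.log_exp, Real.log_inv, hεw,
    hε, Real.log_rpow hw0, ← hε] at hlog
  have h1 : Real.log w ≤ w := (Real.log_le_sub_one_of_pos hw0).trans (by linarith)
  have h2 : (u + 3 * ε) ^ 2 / (2 * v) ≤ u ^ 2 / (2 * v) + 15 / (2 * v) * w := by
    rw [div_mul_eq_mul_div, ← add_div]
    gcongr
    nlinarith
  have h3 := le_abs_self (Real.log (Real.sqrt (2 * Real.pi * v)))
  have h4 := le_mul_of_one_le_right (abs_nonneg (Real.log (Real.sqrt (2 * Real.pi * v)))) hw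
  have h5 := mul_le_mul_of_nonneg_left h1 hβ.le
  rw [Real.rpow_neg hu0.le, ← hwu, ← div_eq_inv_mul, le_div_iff₀ hw0]
  linarith

/-- Let `(X(t), a ≤ t ≤ b)` be a centered Gaussian process with continuous
sample paths, `P(min X > 0) > 0`, whose optimal measure `ν*` has full support in `[a,b]`.
If `E[(X(t)-X(s))²] ≤ σ(|t-s|)²` with `lim_{h↓0} h^{-β} σ(h) = c ∈ (0,∞)`, `β > 0`, then
`liminf_{u→∞} u^{-1/(β+1)} (log P(min X > u) + u²/(2σ*²(a,b))) > -∞`. -/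
theorem gaussian_high_minima_lower_bound_from_small_ball
    {Ω : Type*} [MeasurableSpace Ω] (P : Measure Ω) [IsProbabilityMeasure P]
    (a b : ℝ) (hab : a < b)
    (X : ℝ → Ω → ℝ)
    -- centered Gaussian process on [a,b]
    (hGauss : ∀ (n : ℕ) (t : Fin n → ℝ), (∀ i, t i ∈ Icc a b) → ∀ c : Fin n → ℝ,
      ∃ v : NNReal,
        Measure.map (fun ω => ∑ i, c i * X (t i) ω) P = gaussianReal 0 v)
    -- continuous sample paths
    (hpath : ∀ ω, ContinuousOn (fun t => X t ω) (Icc a b))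
    -- positive probability that the minimum is positive
    (hpos : 0 < P {ω | ∀ t ∈ Icc a b, 0 < X t ω})
    -- covariance function
    (R : ℝ → ℝ → ℝ) (hcov : ∀ s t, R s t = ∫ ω, X s ω * X t ω ∂P)
    -- ν* is an optimal measure with full support in [a,b]
    (νstar : Measure ℝ) (hprob : IsProbabilityMeasure νstar)
    (hsupp : νstar (Icc a b)ᶜ = 0)
    (hopt : ∀ ν : Measure ℝ, IsProbabilityMeasure ν → ν (Icc a b)ᶜ = 0 →
      kernelEnergy R νstar ≤ kernelEnergy R ν)
    (hfull : measSupport νstar = Icc a b)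
    -- the modulus-of-continuity bound
    (β c : ℝ) (hβ : 0 < β) (hc : 0 < c)
    (σfun : ℝ → ℝ) (hσfun_nonneg : ∀ h : ℝ, 0 ≤ h → 0 ≤ σfun h)
    (hσfun_lim : Tendsto (fun h : ℝ => h ^ (-β) * σfun h)
      (nhdsWithin 0 (Ioi 0)) (nhds c))
    (hmodulus : ∀ s ∈ Icc a b, ∀ t ∈ Icc a b,
      (∫ ω, (X t ω - X s ω) ^ 2 ∂P) ≤ σfun |t - s| ^ 2)
    -- σ*²(a,b), the minimal value of the energy
    (σsq : ℝ) (hσsq : σsq = kernelEnergy R νstar) :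
    (⊥ : EReal) <
      Filter.liminf (fun u : ℝ =>
        ((u ^ (-(1 / (β + 1))) *
          (Real.log (P {ω | ∀ t ∈ Icc a b, u < X t ω}).toReal
            + u ^ 2 / (2 * σsq)) : ℝ) : EReal)) Filter.atTop := by
  obtain ⟨F, hFX, hG0⟩ := exists_Lp_curve (P := P) (T := Icc a b) hGauss
  set H := (Submodule.span ℝ (F '' Icc a b)).topologicalClosure with hHdef
  have hH : IsGaussianSubspace P H := hG0.topologicalClosure
  have hFH : ∀ t ∈ Icc a b, F t ∈ H := fun t ht =>
    Submodule.le_topologicalClosure _ (Submodule.subset_span (mem_image_of_mem F ht))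
  have hR : ∀ s ∈ Icc a b, ∀ t ∈ Icc a b, R s t = inner ℝ (F s) (F t) := by
    intro s hs t ht
    rw [hcov, L2.inner_def]
    refine integral_congr_ae ?_
    filter_upwards [hFX s hs, hFX t ht] with ω h1 h2
    simp [h1, h2, mul_comm]
  have hFσ : ∀ s ∈ Icc a b, ∀ t ∈ Icc a b, ‖F t - F s‖ ^ 2 ≤ σfun |t - s| ^ 2 := by
    intro s hs t ht
    refine le_of_eq_of_le ?_ (hmodulus s hs t ht)
    rw [Lp_two_norm_sq]
    refine integral_congr_ae ?_
    filter_upwards [Lp.coeFn_sub (F t) (F s), hFX s hs, hFX t ht] with ω h1 h2 h3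
    rw [h1, Pi.sub_apply, h2, h3]
  obtain ⟨C, hC, hhol⟩ := exists_holder_bound hβ hc hσfun_nonneg hσfun_lim hFσ
  have hF : ContinuousOn F (Icc a b) :=
    continuousOn_of_norm_sub_le_rpow hβ one_pos fun s hs t ht _ => hhol s hs t ht
  set Y := ∫ t, F t ∂νstar with hYdef
  have hYe : σsq = ‖Y‖ ^ 2 := by rw [hσsq, kernelEnergy_eq_norm_sq hF hR hsupp]
  have hY0 : Y ≠ 0 := integral_ne_zero_of_pos hab hpath hpos hFX hF hsupp
  have hYH : Y ∈ H := by
    have hconv : Convex ℝ (H : Set (Lp ℝ 2 P)) := H.convex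
    have hcl : IsClosed (H : Set (Lp ℝ 2 P)) := Submodule.isClosed_topologicalClosure _
    refine hconv.integral_mem hcl ?_ (hF.integrable_of_compl_null hsupp)
    filter_upwards [mem_ae_iff.2 hsupp] with t ht
    exact hFH t ht
  have horth : ∀ t ∈ Icc a b, inner ℝ Y (F t - Y) = 0 := fun t ht => by
    rw [inner_sub_right, inner_integral_eq_of_optimal hF hR hsupp hopt hfull ht,
      real_inner_self_eq_norm_sq, sub_self]
  obtain ⟨B, hB, hinc⟩ := exists_norm_treeIncrement_le (Z := fun t => F t - Y) hab.le hβ hC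
    (fun s hs t ht => by simpa using hhol s hs t ht)
  obtain ⟨A, -, hsmall⟩ := hH.exists_tree_small_ball (fun k i => F (dyadicPoint a b k i) - Y)
    (fun k i hi => H.sub_mem (hFH _ (dyadicPoint_mem hab.le hi)) hYH) hβ hB hinc
  have hv : (‖Y‖₊ ^ 2 : NNReal) ≠ 0 := by simpa using hY0
  have hσ : ((‖Y‖₊ ^ 2 : NNReal) : ℝ) = σsq := by simp [hYe]
  have hσpos : 0 < σsq := by
    rw [hYe]
    have := norm_pos_iff.2 hY0
    positivity
  have hbound : ∀ u ε : ℝ, 0 < u → 0 < ε → ε ≤ 1 →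
      ε * (Real.sqrt (2 * Real.pi * σsq))⁻¹ * Real.exp (-((u + 3 * ε) ^ 2 / (2 * σsq)))
        * Real.exp (-(A * ε ^ (-(1 / β)))) ≤ P.real {ω | ∀ t ∈ Icc a b, u < X t ω} := by
    intro u ε hu hε hε1
    refine le_trans ?_ (hH.real_forall_lt_ge hab hpath hFX hYH hFH horth hε (hsmall ε hε hε1))
    gcongr
    have h1 := gaussianReal_Icc_real_ge hv (x := u + 2 * ε) (ε := ε) (by positivity) hε.le
    rw [hσ, show u + 2 * ε + ε = u + 3 * ε by ring] at h1
    refine h1.trans ?_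
    rw [← hH Y hYH, map_measureReal_apply_of_aemeasurable (Lp_two_aemeasurable Y) measurableSet_Icc]
    exact measureReal_mono fun ω hω => hω.1
  refine (EReal.bot_lt_coe _).trans_le (le_liminf_of_le (by isBoundedDefault)
    (eventually_atTop.2 ⟨1, fun u hu => EReal.coe_le_coe_iff.2
      (rpow_mul_log_add_ge hσpos hβ hbound hu)⟩))
end

section
/- Let (X(t), t ∈ ℝ) be a centered stationary Gaussian process with continuous sample paths and covariance function R_X(t) = exp(−|t|^α) for a fixed 0 < α ≤ 1, let [a,b] be a compact interval, and let σ*²(a,b) = min_{ν∈M1[a,b]} ∫∫ R_X(t−s) ν(ds) ν(dt). Then there exists C ∈ (0,∞) such that for all sufficiently large u, log P( min_{t∈[a,b]} X(t) > u ) ≥ − u²/(2σ*²(a,b)) − C u^{2/(α+2)}. -/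
open MeasureTheory ProbabilityTheory Filter Set Real

/-- The energy functional `I(ν) = ∫∫ R(t-s) ν(ds) ν(dt)` for a stationary covariance
kernel `R`. -/
noncomputable def statEnergy (R : ℝ → ℝ) (ν : Measure ℝ) : ℝ :=
  ∫ s, ∫ t, R (t - s) ∂ν ∂ν

/-- Laws on `ℝ` with equal, everywhere finite moment generating functions coincide. -/
lemma measure_eq_of_mgf_id_eq {μ ν : Measure ℝ} [IsProbabilityMeasure μ] [IsProbabilityMeasure ν]
    (hμ : ∀ s : ℝ, Integrable (fun x => exp (s * x)) μ) (h : mgf id μ = mgf id ν) : μ = ν := by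
  have huniv : integrableExpSet id μ = univ := by
    ext s
    simpa [integrableExpSet] using hμ s
  refine Measure.ext_of_complexMGF_id_eq ?_
  have := eqOn_complexMGF_of_mgf h
  rw [huniv] at this
  ext z
  exact this (by simp)

section GaussianBanach

variable {E : Type*} [NormedAddCommGroup E] [NormedSpace ℝ E] [MeasurableSpace E] [BorelSpace E]
  {μ : Measure E} [IsGaussian μ]

lemma integrable_exp_strongDual (L : StrongDual ℝ E) : Integrable (fun x => exp (L x)) μ := by
  have h := integrable_exp_mul_gaussianReal (μ := μ[L]) (v := Var[L; μ].toNNReal) 1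
  rw [← IsGaussian.map_eq_gaussianReal L, integrable_map_measure (by fun_prop) (by fun_prop)] at h
  simpa [Function.comp_def] using h

lemma integral_exp_strongDual (hμ : ∀ L : StrongDual ℝ E, μ[L] = 0) (L : StrongDual ℝ E) :
    ∫ x, exp (L x) ∂μ = exp ((∫ x, L x * L x ∂μ) / 2) := by
  have h := mgf_gaussianReal (IsGaussian.map_eq_gaussianReal (μ := μ) L) 1
  have hv : Var[L; μ] = ∫ x, L x * L x ∂μ := by
    rw [variance_of_integral_eq_zero (by fun_prop) (hμ L)]
    simp [pow_two]
  have h0 : 0 ≤ ∫ x, L x * L x ∂μ := hv ▸ variance_nonneg _ _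
  rw [mgf, hμ L, hv, Real.coe_toNNReal _ h0] at h
  simpa using h

/-- The Cameron–Martin formula for a centered Gaussian measure. -/
lemma tilted_strongDual_eq_map_add [SecondCountableTopology E] [CompleteSpace E]
    (hμ : ∀ L : StrongDual ℝ E, μ[L] = 0) (l : StrongDual ℝ E) (m : E)
    (hm : ∀ L : StrongDual ℝ E, ∫ x, l x * L x ∂μ = L m) :
    μ.tilted l = μ.map (fun x => x + m) := by
  have : IsProbabilityMeasure (μ.tilted l) :=
    isProbabilityMeasure_tilted (integrable_exp_strongDual l)
  have hprod (L M : StrongDual ℝ E) : Integrable (fun x => L x * M x) μ :=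
    (IsGaussian.memLp_dual μ L 2 (by simp)).integrable_mul (IsGaussian.memLp_dual μ M 2 (by simp))
  refine Measure.ext_of_charFunDual ?_
  ext L
  rw [charFunDual_eq_charFun_map_one, charFunDual_eq_charFun_map_one]
  congr 1
  have : IsProbabilityMeasure ((μ.tilted l).map L) := Measure.isProbabilityMeasure_map (by fun_prop)
  have : IsProbabilityMeasure ((μ.map (fun x => x + m)).map L) :=
    Measure.isProbabilityMeasure_map (by fun_prop)
  refine measure_eq_of_mgf_id_eq (fun s => ?_) ?_
  · rw [integrable_map_measure (by fun_prop) (by fun_prop), integrable_tilted_iff]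
    · have := integrable_exp_strongDual (μ := μ) (l + s • L)
      simpa [Function.comp_def, exp_add] using this
    · exact integrable_exp_strongDual l
  · ext s
    rw [mgf_id_map (by fun_prop), mgf_id_map (by fun_prop), mgf, mgf, integral_exp_tilted,
      integral_map (by fun_prop) (by fun_prop)]
    have e1 : ∫ x, exp ((⇑l + fun x => s * L x) x) ∂μ
        = exp ((l m + 2 * s * L m + s ^ 2 * ∫ x, L x * L x ∂μ) / 2) := by
      have := integral_exp_strongDual hμ (l + s • L)
      simp only [add_apply, smul_apply, smul_eq_mul] at this
      simp only [Pi.add_apply]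
      rw [this]
      congr 2
      have : ∀ x, (l x + s * L x) * (l x + s * L x)
          = l x * l x + (2 * s) * (l x * L x) + s ^ 2 * (L x * L x) := fun x => by ring
      simp_rw [this]
      rw [integral_add (f := fun x => l x * l x + (2 * s) * (l x * L x))
          ((hprod _ _).add ((hprod _ _).const_mul _)) ((hprod _ _).const_mul _),
        integral_add (hprod _ _) ((hprod _ _).const_mul _), integral_const_mul, integral_const_mul,
        hm, hm]
    have e2 : ∫ x, exp (s * L (x + m)) ∂μ = exp ((s ^ 2 * ∫ x, L x * L x ∂μ) / 2) * exp (s * L m) := by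
      have := integral_exp_strongDual hμ (s • L)
      simp only [smul_apply, smul_eq_mul] at this
      simp_rw [map_add, mul_add, exp_add, integral_mul_const, this]
      congr 3
      rw [← integral_const_mul]
      congr 1
      ext x
      ring
    rw [e1, e2, integral_exp_strongDual hμ, hm, ← exp_sub, ← exp_add]
    congr 1
    ring

/-- Translating a symmetric set by `m` in the Cameron–Martin space decreases its centered Gaussian
measure by a factor at most `exp (-‖m‖² / 2)`. -/
lemma exp_mul_measureReal_le_measureReal_sub_mem [SecondCountableTopology E] [CompleteSpace E]
    (hμ : ∀ L : StrongDual ℝ E, μ[L] = 0) (l : StrongDual ℝ E) (m : E)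
    (hm : ∀ L : StrongDual ℝ E, ∫ x, l x * L x ∂μ = L m)
    {B : Set E} (hB : MeasurableSet B) (hsymm : ∀ x, -x ∈ B ↔ x ∈ B) :
    exp (-(l m) / 2) * μ.real B ≤ μ.real {x | x - m ∈ B} := by
  have hneg : μ.map (fun x => -x) = μ := by
    refine Measure.ext_of_charFunDual ?_
    ext L
    rw [IsGaussian.charFunDual_eq, IsGaussian.charFunDual_eq]
    have h1 : ∫ x, L x ∂(μ.map (fun x => -x)) = 0 := by
      rw [integral_map (by fun_prop) (by fun_prop)]
      simp only [map_neg, integral_neg, hμ, neg_zero]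
    have h2 : Var[L; μ.map (fun x => -x)] = Var[L; μ] := by
      rw [variance_map (by fun_prop) (by fun_prop)]
      have : (⇑L ∘ fun x => -x) = -⇑L := by ext; simp
      rw [this, variance_neg]
    rw [h2, integral_complex_ofReal, integral_complex_ofReal, h1, hμ]
  have hformula : ∀ l' : StrongDual ℝ E, ∀ m', (∀ L : StrongDual ℝ E, ∫ x, l' x * L x ∂μ = L m') →
      μ.real {x | x + m' ∈ B} = (∫ x in B, exp (l' x) ∂μ) / exp (l' m' / 2) := by
    intro l' m' h
    have h1 : μ.real {x | x + m' ∈ B} = (μ.map (fun x => x + m')).real B := by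
      rw [map_measureReal_apply (by fun_prop) hB]; rfl
    rw [h1, ← tilted_strongDual_eq_map_add hμ l' m' h, measureReal_def, tilted_apply_eq_ofReal_integral' _ hB,
      ENNReal.toReal_ofReal (by positivity), integral_div, integral_exp_strongDual hμ, h]
  have hplus := hformula l m hm
  have hminus := hformula (-l) (-m) (by
    intro L
    simp only [neg_apply, neg_mul, integral_neg, hm, map_neg])
  have hsame : μ.real {x | x + m ∈ B} = μ.real {x | x + -m ∈ B} := by
    conv_lhs => rw [← hneg]
    rw [map_measureReal_apply (by fun_prop)
      (show MeasurableSet {x | x + m ∈ B} from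
        measurableSet_preimage (f := fun x => x + m) (by fun_prop) hB)]
    congr 1
    ext x
    simp only [mem_preimage, mem_ofPred_eq]
    rw [← hsymm, neg_add, neg_neg]
  have hsub : {x : E | x - m ∈ B} = {x | x + -m ∈ B} := by simp [sub_eq_add_neg]
  have hint (l' : StrongDual ℝ E) : IntegrableOn (fun x => exp (l' x)) B μ :=
    (integrable_exp_strongDual l').integrableOn
  have hcosh : 2 * μ.real B ≤ (∫ x in B, exp (l x) ∂μ) + ∫ x in B, exp ((-l) x) ∂μ := by
    rw [← integral_add (hint _) (hint _)]
    have : 2 * μ.real B = ∫ x in B, (2 : ℝ) ∂μ := by simp [mul_comm]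
    rw [this]
    refine integral_mono (by simp) ((hint _).add (hint _)) fun x => ?_
    have h1 := add_one_le_exp (l x)
    have h2 := add_one_le_exp (-l x)
    simp only [neg_apply]
    linarith
  have hpos := exp_pos (l m / 2)
  simp only [neg_apply, map_neg, neg_neg] at hminus
  rw [hsub, neg_div, exp_neg, inv_mul_le_iff₀ hpos]
  rw [hsame, eq_div_iff hpos.ne'] at hplus
  rw [eq_div_iff hpos.ne'] at hminus
  simp only [neg_apply] at hcosh
  linarith

/-- The normalised difference of two independent copies of a centered Gaussian vector has the same
law as the vector itself. -/
lemma prod_measureReal_sub_mem [SecondCountableTopology E] [CompleteSpace E]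
    (hμ : ∀ L : StrongDual ℝ E, μ[L] = 0) {B : Set E} (hB : MeasurableSet B) :
    (μ.prod μ).real {p | (√2)⁻¹ • (p.1 - p.2) ∈ B} = μ.real B := by
  have hrot := IsGaussian.map_rotation_eq_self_of_forall_strongDual_eq_zero hμ (-(π / 4))
  have h1 : μ.real B = (μ.prod μ).real (B ×ˢ univ) := by
    simp [measureReal_prod_prod]
  rw [h1]
  conv_rhs => rw [← hrot]
  rw [map_measureReal_apply (by fun_prop) (hB.prod .univ)]
  congr 1
  ext p
  have : √2 / 2 = (√2)⁻¹ := by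
    rw [div_eq_iff two_ne_zero, eq_comm, inv_mul_eq_iff_eq_mul₀ (by positivity)]
    simp
  simp [ContinuousLinearMap.rotation_apply, this, sub_eq_add_neg]

end GaussianBanach

/-- Two independent copies of a discrete random variable coincide with probability at least
`P(c ∈ S)² / |S|`. -/
lemma sq_measureReal_le_card_mul_prod_measureReal_eq {Ω κ : Type*} [MeasurableSpace Ω]
    [MeasurableSpace κ] [MeasurableSingletonClass κ] [Countable κ]
    (P : Measure Ω) [IsProbabilityMeasure P]
    {c : Ω → κ} (hc : Measurable c) (S : Finset κ) :
    P.real (c ⁻¹' S) ^ 2 ≤ S.card * (P.prod P).real {p | c p.1 = c p.2} := by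
  have hm (s : κ) : MeasurableSet (c ⁻¹' {s}) := hc (measurableSet_singleton s)
  have hdisj : (S : Set κ).PairwiseDisjoint fun s => c ⁻¹' {s} := by
    intro s _ t _ hst
    exact Disjoint.preimage _ (by simpa using hst)
  have h1 : P.real (c ⁻¹' S) = ∑ s ∈ S, P.real (c ⁻¹' {s}) := by
    rw [← measureReal_biUnion_finset hdisj fun s _ => hm s]
    congr 1
    ext ω
    simp
  have h2 : ∑ s ∈ S, P.real (c ⁻¹' {s}) ^ 2 ≤ (P.prod P).real {p | c p.1 = c p.2} := by
    have : ∀ s ∈ S, P.real (c ⁻¹' {s}) ^ 2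
        = (P.prod P).real ((c ⁻¹' {s}) ×ˢ (c ⁻¹' {s})) := fun s _ => by
      rw [measureReal_prod_prod, pow_two]
    rw [Finset.sum_congr rfl this, ← measureReal_biUnion_finset]
    · refine measureReal_mono fun p hp => ?_
      simp only [mem_iUnion, mem_prod, mem_preimage, mem_singleton_iff] at hp
      obtain ⟨s, -, h, h'⟩ := hp
      exact h.trans h'.symm
    · intro s hs t ht hst
      exact Set.disjoint_prod.2 (Or.inl (hdisj hs ht hst))
    · exact fun s _ => (hm s).prod (hm s)
  rw [h1]
  exact sq_sum_le_card_mul_sum_sq.trans (by gcongr)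

lemma sum_exp_neg_mul_abs_le {l : ℝ} (hl : 1 ≤ l) (M : ℕ) :
    ∑ m ∈ Finset.Icc (-(M : ℤ)) M, exp (-(l * |(m : ℝ)|)) ≤ exp (4 * exp (-l)) := by
  have hsum : ∑ m ∈ Finset.Icc (-(M : ℤ)) M, exp (-(l * |(m : ℝ)|))
      = 1 + 2 * ∑ k ∈ Finset.range M, exp (-l) ^ (k + 1) := by
    induction M with
    | zero => simp
    | succ M ih =>
      have hIcc : Finset.Icc (-((M + 1 : ℕ) : ℤ)) ((M + 1 : ℕ) : ℤ)
          = insert ((M : ℤ) + 1) (insert (-((M : ℤ) + 1)) (Finset.Icc (-(M : ℤ)) M)) := by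
        ext x
        simp only [Finset.mem_Icc, Finset.mem_insert]
        push_cast
        omega
      rw [hIcc, Finset.sum_insert, Finset.sum_insert, ih, Finset.sum_range_succ]
      · have h : |((M : ℝ) + 1)| = M + 1 := abs_of_nonneg (by positivity)
        have h' : |(-1 + -(M : ℝ))| = M + 1 := by rw [← h, ← abs_neg]; congr 1; ring
        have he : exp (-(l * ((M : ℝ) + 1))) = exp (-l) ^ (M + 1) := by
          rw [← exp_nat_mul]
          congr 1
          push_cast
          ring
        push_cast
        simp only [neg_add_rev, h, h', he]
        ring
      · simp
      · simp only [Finset.mem_insert, Finset.mem_Icc, not_or]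
        omega
  have hq : exp (-l) ≤ 1 / 2 := by
    have : exp (-l) ≤ exp (-1) := exp_le_exp.2 (by linarith)
    have h2 := exp_neg_one_lt_d9
    norm_num at h2 ⊢
    linarith
  have hq0 := exp_pos (-l)
  have hgeom : ∑ k ∈ Finset.range M, exp (-l) ^ (k + 1) ≤ 2 * exp (-l) := by
    have : ∑ k ∈ Finset.range M, exp (-l) ^ (k + 1)
        = exp (-l) * ∑ k ∈ Finset.range M, exp (-l) ^ k := by
      rw [Finset.mul_sum]
      exact Finset.sum_congr rfl fun k _ => by ring
    rw [this, mul_comm]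
    gcongr
    refine ((summable_geometric_of_lt_one hq0.le (by linarith)).sum_le_tsum _
      fun _ _ => by positivity).trans ?_
    rw [tsum_geometric_of_lt_one hq0.le (by linarith)]
    exact inv_le_of_inv_le₀ (by norm_num) (by linarith)
  rw [hsum]
  linarith [add_one_le_exp (4 * exp (-l))]

/-- The number of integer vectors of bounded weighted `ℓ¹` norm. -/
lemma exists_finset_weighted_norm_le {ι : Type*} [Fintype ι] (l : ι → ℝ) (hl : ∀ i, 1 ≤ l i)
    (R : ℝ) :
    ∃ S : Finset (ι → ℤ), (∀ c : ι → ℤ, ∑ i, l i * |(c i : ℝ)| ≤ R → c ∈ S) ∧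
      (S.card : ℝ) ≤ exp (R + 4 * ∑ i, exp (-l i)) := by
  classical
  set M : ℕ := ⌈R⌉₊
  set box : Finset (ι → ℤ) := Fintype.piFinset fun _ => Finset.Icc (-(M : ℤ)) M
  refine ⟨box.filter fun c => ∑ i, l i * |(c i : ℝ)| ≤ R, fun c hc => ?_, ?_⟩
  · refine Finset.mem_filter.2 ⟨Fintype.mem_piFinset.2 fun i => ?_, hc⟩
    have h1 : |(c i : ℝ)| ≤ R := by
      refine le_trans ?_ hc
      refine le_trans ?_ (Finset.single_le_sum (f := fun i => l i * |(c i : ℝ)|)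
        (fun j _ => by have := hl j; positivity) (Finset.mem_univ i))
      exact le_mul_of_one_le_left (abs_nonneg _) (hl i)
    have h2 : |(c i : ℝ)| ≤ M := h1.trans (Nat.le_ceil R)
    rw [Finset.mem_Icc, ← abs_le]
    exact_mod_cast h2
  · calc ((box.filter fun c => ∑ i, l i * |(c i : ℝ)| ≤ R).card : ℝ)
        = ∑ c ∈ box.filter (fun c => ∑ i, l i * |(c i : ℝ)| ≤ R), (1 : ℝ) := by simp
      _ ≤ ∑ c ∈ box.filter (fun c => ∑ i, l i * |(c i : ℝ)| ≤ R),
          exp (R - ∑ i, l i * |(c i : ℝ)|) := by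
        refine Finset.sum_le_sum fun c hc => one_le_exp ?_
        linarith [(Finset.mem_filter.1 hc).2]
      _ ≤ ∑ c ∈ box, exp (R - ∑ i, l i * |(c i : ℝ)|) :=
        Finset.sum_le_sum_of_subset_of_nonneg (Finset.filter_subset _ _)
          fun _ _ _ => (exp_pos _).le
      _ = exp R * ∑ c ∈ box, ∏ i, exp (-(l i * |(c i : ℝ)|)) := by
        rw [Finset.mul_sum]
        refine Finset.sum_congr rfl fun c _ => ?_
        rw [← exp_sum, ← exp_add, Finset.sum_neg_distrib, sub_eq_add_neg]
      _ = exp R * ∏ i, ∑ m ∈ Finset.Icc (-(M : ℤ)) M, exp (-(l i * |(m : ℝ)|)) := by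
        rw [Finset.prod_univ_sum]
      _ ≤ exp R * ∏ i, exp (4 * exp (-l i)) := by
        gcongr with i
        exact sum_exp_neg_mul_abs_le (hl i) M
      _ = exp (R + 4 * ∑ i, exp (-l i)) := by
        rw [← exp_sum, ← exp_add, Finset.mul_sum]

/-- If an integer-valued random vector has small weighted `ℓ¹` norm in mean, then two independent
copies of it coincide with probability bounded below. -/
lemma exp_neg_le_prod_measureReal_eq {Ω ι : Type*} [MeasurableSpace Ω] [Fintype ι]
    (P : Measure Ω) [IsProbabilityMeasure P] {c : Ω → ι → ℤ} (hc : Measurable c)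
    (l : ι → ℝ) (hl : ∀ i, 1 ≤ l i) (hint : ∀ i, Integrable (fun ω => |(c ω i : ℝ)|) P) (R : ℝ)
    (hR : ∑ i, l i * ∫ ω, |(c ω i : ℝ)| ∂P ≤ R) :
    exp (-(3 + 2 * R + 4 * ∑ i, exp (-l i))) ≤ (P.prod P).real {p | c p.1 = c p.2} := by
  obtain ⟨S, hS, hcard⟩ := exists_finset_weighted_norm_le l hl (2 * R + 1)
  set f : Ω → ℝ := fun ω => ∑ i, l i * |(c ω i : ℝ)|
  have hfint : Integrable f P := integrable_finsetSum _ fun i _ => (hint i).const_mul _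
  have hf0 : 0 ≤ f := fun ω => Finset.sum_nonneg fun i _ => by have := hl i; positivity
  have hEf : ∫ ω, f ω ∂P ≤ R := by
    rw [integral_finsetSum _ fun i _ => (hint i).const_mul _]
    simpa only [integral_const_mul] using hR
  have hR0 : 0 ≤ R := (integral_nonneg hf0).trans hEf
  have hmarkov := mul_meas_ge_le_integral_of_nonneg (.of_forall hf0) hfint (2 * R + 1)
  have hhalf : P.real {ω | 2 * R + 1 ≤ f ω} ≤ 1 / 2 := by
    by_contra! h
    nlinarith
  have hSm : MeasurableSet (c ⁻¹' S) := hc S.measurableSet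
  have hbig : 1 / 2 ≤ P.real (c ⁻¹' S) := by
    have hcompl : P.real (c ⁻¹' S)ᶜ ≤ 1 / 2 := by
      refine (measureReal_mono fun ω hω => ?_).trans hhalf
      by_contra h
      exact hω (hS _ (le_of_lt (not_le.1 h)))
    rw [probReal_compl_eq_one_sub hSm] at hcompl
    linarith
  have hpair := sq_measureReal_le_card_mul_prod_measureReal_eq P hc S
  have h4 : 1 / 4 ≤ exp (2 * R + 1 + 4 * ∑ i, exp (-l i)) * (P.prod P).real {p | c p.1 = c p.2} := by
    calc (1 / 4 : ℝ) ≤ P.real (c ⁻¹' S) ^ 2 := by nlinarith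
      _ ≤ _ := hpair
      _ ≤ _ := by gcongr
  have h5 : exp (-1) ≤ 1 / 2 := by
    have h2 := exp_neg_one_lt_d9
    norm_num at h2 ⊢
    linarith
  have hsplit : exp (-(3 + 2 * R + 4 * ∑ i, exp (-l i)))
      = exp (-1) * exp (-1) * (exp (2 * R + 1 + 4 * ∑ i, exp (-l i)))⁻¹ := by
    rw [← exp_neg, ← exp_add, ← exp_add]
    congr 1
    ring
  rw [hsplit, mul_inv_le_iff₀ (exp_pos _)]
  nlinarith [exp_pos (-1)]

lemma abs_sub_le_one_of_round_eq {x y : ℝ} (h : round x = round y) : |x - y| ≤ 1 := by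
  have hx := abs_le.1 (abs_sub_round x)
  have hy := abs_le.1 (abs_sub_round y)
  rw [h] at hx
  rw [abs_le]
  constructor <;> linarith

lemma abs_round_le_abs_add_one (x : ℝ) : |(round x : ℝ)| ≤ |x| + 1 / 2 := by
  have hx := abs_sub_round x
  rw [abs_sub_comm] at hx
  linarith [abs_sub_abs_le_abs_sub (round x : ℝ) x]

lemma abs_round_le_two_mul_pow (x : ℝ) {p : ℕ} (hp : 1 ≤ p) : |(round x : ℝ)| ≤ (2 * |x|) ^ p := by
  rcases lt_or_ge |x| (1 / 2) with h | h
  · have : round x = 0 := by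
      rw [round_eq_zero_iff]
      have := abs_lt.1 h
      exact ⟨this.1.le, this.2⟩
    rw [this]
    simp only [Int.cast_zero, abs_zero]
    positivity
  · calc |(round x : ℝ)| ≤ |x| + 1 / 2 := abs_round_le_abs_add_one x
      _ ≤ 2 * |x| := by linarith
      _ ≤ (2 * |x|) ^ p := le_self_pow₀ (by linarith) (by omega)

/-- The code of a path: at the coarsest level the increments of the quantised path, at finer levels
the quantised differences with the parent node. -/
noncomputable def dyadicCode {Ω : Type*} (W : ℕ → ℕ → Ω → ℝ) (ε : ℕ → ℝ) : ℕ → ℕ → Ω → ℤ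
  | 0, 0, ω => round (W 0 0 ω / ε 0)
  | 0, i + 1, ω => round (W 0 (i + 1) ω / ε 0) - round (W 0 i ω / ε 0)
  | k + 1, i, ω => round ((W (k + 1) i ω - W k (i / 2) ω) / ε (k + 1))

section DyadicCode

variable {Ω : Type*} {W : ℕ → ℕ → Ω → ℝ} {ε : ℕ → ℝ}

lemma abs_sub_le_sum_of_dyadicCode_eq (hε : ∀ k, 0 < ε k) {N n : ℕ} {ω ω' : Ω}
    (h : ∀ k ≤ n, ∀ i ≤ N * 2 ^ k, dyadicCode W ε k i ω = dyadicCode W ε k i ω') :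
    ∀ k ≤ n, ∀ i ≤ N * 2 ^ k, |W k i ω - W k i ω'| ≤ ∑ j ∈ Finset.range (k + 1), ε j := by
  have hscale {e x y : ℝ} (he : 0 < e) (hxy : round (x / e) = round (y / e)) : |x - y| ≤ e := by
    have := abs_sub_le_one_of_round_eq hxy
    rwa [← sub_div, abs_div, abs_of_pos he, div_le_one he] at this
  intro k
  induction k with
  | zero =>
    intro _ i hi
    have hround : round (W 0 i ω / ε 0) = round (W 0 i ω' / ε 0) := by
      induction i with
      | zero => simpa [dyadicCode] using h 0 (by omega) 0 (by omega)
      | succ i ih =>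
        have h1 := h 0 (by omega) (i + 1) hi
        simp only [dyadicCode] at h1
        have h2 := ih (by omega)
        omega
    simpa using hscale (hε 0) hround
  | succ k ih =>
    intro hk i hi
    have h1 := ih (by omega) (i / 2) (by rw [pow_succ, ← mul_assoc] at hi; omega)
    have h2 := hscale (hε (k + 1)) (h (k + 1) hk i hi)
    rw [Finset.sum_range_succ]
    have h3 : W (k + 1) i ω - W (k + 1) i ω' = (W k (i / 2) ω - W k (i / 2) ω')
        + (W (k + 1) i ω - W k (i / 2) ω - (W (k + 1) i ω' - W k (i / 2) ω')) := by ring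
    rw [h3]
    exact (abs_add_le _ _).trans (by linarith)

variable [MeasurableSpace Ω]

lemma measurable_round_real : Measurable (round : ℝ → ℤ) := by
  simp_rw [show (round : ℝ → ℤ) = fun x => ⌊x + 1 / 2⌋ from funext fun x => round_eq x]
  fun_prop

lemma measurable_dyadicCode (hW : ∀ k i, Measurable (W k i)) :
    ∀ k i, Measurable (dyadicCode W ε k i)
  | 0, 0 => measurable_round_real.comp ((hW 0 0).div_const _)
  | 0, i + 1 => (measurable_round_real.comp ((hW 0 (i + 1)).div_const _)).sub
      (measurable_round_real.comp ((hW 0 i).div_const _))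
  | k + 1, i => measurable_round_real.comp (((hW (k + 1) i).sub (hW k (i / 2))).div_const _)

end DyadicCode

/-- Entropy bound by chaining: two independent copies of a process, whose `p`-th moments of
increments decay along a dyadic tree, are uniformly `δ`-close with probability at least
`exp (-C N)`, where `N` is the number of nodes on the coarsest level. -/
lemma exists_exp_neg_mul_le_prod_measureReal_abs_sub_le {r A : ℝ} {p : ℕ} (hr0 : 0 < r)
    (hr1 : r < 1) (hp : 1 ≤ p) (hrp : r ^ p ≤ 1 / 8) (hA : 0 ≤ A) :
    ∃ C : ℝ, ∀ {Ω : Type*} [MeasurableSpace Ω] (P : Measure Ω) [IsProbabilityMeasure P]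
      (W : ℕ → ℕ → Ω → ℝ) (_ : ∀ k i, Measurable (W k i)) (N : ℕ) (_ : 1 ≤ N) (δ : ℝ) (_ : 0 < δ)
      (_ : Integrable (W 0 0) P) (_ : ∫ ω, |W 0 0 ω| ∂P ≤ A * N * δ)
      (_ : ∀ i, Integrable (fun ω => W 0 (i + 1) ω - W 0 i ω) P)
      (_ : ∀ i, ∫ ω, |W 0 (i + 1) ω - W 0 i ω| ∂P ≤ A * δ)
      (_ : ∀ k i, Integrable (fun ω => |W (k + 1) i ω - W k (i / 2) ω| ^ p) P)
      (_ : ∀ k i, ∫ ω, |W (k + 1) i ω - W k (i / 2) ω| ^ p ∂P ≤ A * (δ * r ^ (2 * (k + 1))) ^ p)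
      (n : ℕ),
      exp (-(C * N)) ≤ (P.prod P).real
        {q | ∀ k ≤ n, ∀ i ≤ N * 2 ^ k, |W k i q.1 - W k i q.2| ≤ δ} := by
  set C₁ : ℝ := A / (1 - r) + 1
  set C₂ : ℝ := A * (2 / (1 - r)) ^ p
  have hr' : 0 < 1 - r := by linarith
  have hC₁ : 0 ≤ C₁ := by positivity
  have hC₂ : 0 ≤ C₂ := by positivity
  refine ⟨19 + 4 * (2 * C₁ + 6 * C₂), ?_⟩
  intro Ω _ P _ W hW N hN δ hδ hi0 h0 hi1 h1 hi2 h2 n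
  set ε : ℕ → ℝ := fun k => δ * (1 - r) * r ^ k
  have hε : ∀ k, 0 < ε k := fun k => by positivity
  have hNr : (1 : ℝ) ≤ N := by exact_mod_cast hN
  have hcm := measurable_dyadicCode (ε := ε) hW
  have hca (k i : ℕ) : AEStronglyMeasurable (fun ω => |(dyadicCode W ε k i ω : ℝ)|) P :=
    ((measurable_from_top (f := fun z : ℤ => |(z : ℝ)|)).comp (hcm k i)).aestronglyMeasurable
  -- moments of the codes
  have hmom (k i : ℕ) : Integrable (fun ω => |(dyadicCode W ε k i ω : ℝ)|) P ∧
      ∫ ω, |(dyadicCode W ε k i ω : ℝ)| ∂P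
        ≤ (if k = 0 then (if i = 0 then C₁ * N else C₁) else C₂ * (1 / 8) ^ k) := by
    have key {f g : Ω → ℝ} {b : ℝ} (hf : AEStronglyMeasurable (fun ω => |f ω|) P)
        (hg : Integrable g P)
        (hfg : ∀ ω, |f ω| ≤ g ω) (hb : ∫ ω, g ω ∂P ≤ b) :
        Integrable (fun ω => |f ω|) P ∧ ∫ ω, |f ω| ∂P ≤ b := by
      have hI : Integrable (fun ω => |f ω|) P :=
        hg.mono' hf (.of_forall fun ω => by simpa using hfg ω)
      exact ⟨hI, (integral_mono hI hg hfg).trans hb⟩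
    match k, i with
    | 0, 0 =>
      refine key (g := fun ω => |W 0 0 ω| / ε 0 + 1 / 2) (hca 0 0)
        ((hi0.abs.div_const _).add (integrable_const _)) (fun ω => ?_) ?_
      · have := abs_round_le_abs_add_one (W 0 0 ω / ε 0)
        rwa [abs_div, abs_of_pos (hε 0)] at this
      · rw [integral_add (hi0.abs.div_const _) (integrable_const _), integral_div]
        have : (∫ ω, |W 0 0 ω| ∂P) / ε 0 ≤ A / (1 - r) * N := by
          rw [div_le_iff₀ (hε 0)]
          refine h0.trans (le_of_eq ?_)
          simp only [ε]
          field_simp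
        simp [C₁]
        linarith
    | 0, i + 1 =>
      refine key (g := fun ω => |W 0 (i + 1) ω - W 0 i ω| / ε 0 + 1) (hca 0 (i + 1))
        (((hi1 i).abs.div_const _).add (integrable_const _)) (fun ω => ?_) ?_
      · have ha := abs_le.1 (abs_sub_round (W 0 (i + 1) ω / ε 0))
        have hb := abs_le.1 (abs_sub_round (W 0 i ω / ε 0))
        have hc := abs_le.1 (le_refl |(W 0 (i + 1) ω - W 0 i ω) / ε 0|)
        have hd : |W 0 (i + 1) ω - W 0 i ω| / ε 0 = |(W 0 (i + 1) ω - W 0 i ω) / ε 0| := by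
          rw [abs_div, abs_of_pos (hε 0)]
        simp only [dyadicCode, hd]
        push_cast
        rw [sub_div] at hc ⊢
        rw [abs_le]
        constructor <;> linarith
      · rw [integral_add ((hi1 i).abs.div_const _) (integrable_const _), integral_div]
        have : (∫ ω, |W 0 (i + 1) ω - W 0 i ω| ∂P) / ε 0 ≤ A / (1 - r) := by
          rw [div_le_iff₀ (hε 0)]
          refine (h1 i).trans (le_of_eq ?_)
          simp only [ε]
          field_simp
        simp [C₁]
        linarith
    | k + 1, i =>
      refine key (g := fun ω => (2 / ε (k + 1)) ^ p * |W (k + 1) i ω - W k (i / 2) ω| ^ p)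
        (hca (k + 1) i) ((hi2 k i).const_mul _) (fun ω => ?_) ?_
      · have := abs_round_le_two_mul_pow ((W (k + 1) i ω - W k (i / 2) ω) / ε (k + 1)) hp
        rw [abs_div, abs_of_pos (hε _)] at this
        refine this.trans (le_of_eq ?_)
        rw [← mul_pow]
        congr 1
        ring
      · rw [integral_const_mul]
        calc (2 / ε (k + 1)) ^ p * ∫ ω, |W (k + 1) i ω - W k (i / 2) ω| ^ p ∂P
            ≤ (2 / ε (k + 1)) ^ p * (A * (δ * r ^ (2 * (k + 1))) ^ p) := by
              have := hε (k + 1)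
              gcongr
              exact h2 k i
          _ = A * (2 / ε (k + 1) * (δ * r ^ (2 * (k + 1)))) ^ p := by rw [mul_pow]; ring
          _ = A * (2 / (1 - r) * r ^ (k + 1)) ^ p := by
              congr 2
              simp only [ε]
              field_simp
              ring
          _ = C₂ * (r ^ p) ^ (k + 1) := by
              simp only [C₂]
              rw [mul_pow, ← pow_mul, ← pow_mul, mul_comm p]
              ring
          _ ≤ C₂ * (1 / 8) ^ (k + 1) := by gcongr
          _ = _ := by simp
  -- the code of the path up to level `n`
  set ι := Σ k : Fin (n + 1), Fin (N * 2 ^ (k : ℕ) + 1)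
  set c : Ω → ι → ℤ := fun ω j => dyadicCode W ε j.1 j.2 ω
  have hc : Measurable c := measurable_pi_lambda _ fun j => hcm _ _
  set l : ι → ℝ := fun j => 1 + 2 * ((j.1 : ℕ) : ℝ)
  have hgeom : ∀ n : ℕ, ∑ k ∈ Finset.range n, (1 / 2 : ℝ) ^ k ≤ 2 := fun n => by
    refine (summable_geometric_two.sum_le_tsum _ fun _ _ => by positivity).trans ?_
    rw [tsum_geometric_two]
  have hcount (k : ℕ) : ((N * 2 ^ k + 1 : ℕ) : ℝ) ≤ 2 * N * 2 ^ k := by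
    push_cast
    have : (1 : ℝ) ≤ 2 ^ k := one_le_pow₀ (by norm_num)
    nlinarith
  have hmean : ∑ j, l j * ∫ ω, |(c ω j : ℝ)| ∂P ≤ 2 * ((2 * C₁ + 6 * C₂) * N) := by
    have hlevel (k : ℕ) : ∑ i : Fin (N * 2 ^ k + 1),
        (1 + 2 * (k : ℝ)) * ∫ ω, |(dyadicCode W ε k i ω : ℝ)| ∂P
          ≤ (2 * C₁ + 6 * C₂) * N * (1 / 2) ^ k := by
      match k with
      | 0 =>
        rw [Fin.sum_univ_succ]
        have ha := (hmom 0 0).2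
        have hb : ∑ i : Fin (N * 2 ^ 0), ∫ ω, |(dyadicCode W ε 0 (i + 1) ω : ℝ)| ∂P ≤ N * C₁ := by
          have hi (i : Fin (N * 2 ^ 0)) :
              ∫ ω, |(dyadicCode W ε 0 (i + 1) ω : ℝ)| ∂P ≤ C₁ := by
            simpa using (hmom 0 ((i : ℕ) + 1)).2
          refine (Finset.sum_le_sum fun i _ => hi i).trans ?_
          simp
        simp at ha hb ⊢
        nlinarith
      | k + 1 =>
        have hk : (1 + 2 * ((k + 1 : ℕ) : ℝ)) ≤ 3 * 2 ^ (k + 1) := by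
          have h1 : ((k + 1 : ℕ) : ℝ) ≤ 2 ^ (k + 1) := by exact_mod_cast Nat.lt_two_pow_self.le
          have h2 : (1 : ℝ) ≤ 2 ^ (k + 1) := one_le_pow₀ (by norm_num)
          linarith
        calc _ ≤ ∑ i : Fin (N * 2 ^ (k + 1) + 1), (3 * 2 ^ (k + 1)) * (C₂ * (1 / 8) ^ (k + 1)) := by
              refine Finset.sum_le_sum fun i _ => ?_
              have := (hmom (k + 1) i).2
              simp only [Nat.add_eq_zero_iff, one_ne_zero, and_false, if_false] at this
              exact mul_le_mul hk this (integral_nonneg fun ω => abs_nonneg _) (by positivity)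
          _ = ((N * 2 ^ (k + 1) + 1 : ℕ) : ℝ) * ((3 * 2 ^ (k + 1)) * (C₂ * (1 / 8) ^ (k + 1))) := by
              simp
          _ ≤ (2 * N * 2 ^ (k + 1)) * ((3 * 2 ^ (k + 1)) * (C₂ * (1 / 8) ^ (k + 1))) := by
              gcongr
              exact hcount _
          _ = 6 * C₂ * N * ((2 * 2 * (1 / 8)) ^ (k + 1)) := by
              rw [mul_pow, mul_pow]
              ring
          _ = 6 * C₂ * N * (1 / 2) ^ (k + 1) := by norm_num
          _ ≤ _ := by
              gcongr
              linarith
    rw [Fintype.sum_sigma, Fin.sum_univ_eq_sum_range (fun k => ∑ i : Fin (N * 2 ^ k + 1),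
      (1 + 2 * (k : ℝ)) * ∫ ω, |(dyadicCode W ε k i ω : ℝ)| ∂P)]
    refine (Finset.sum_le_sum fun k _ => hlevel k).trans ?_
    rw [← Finset.mul_sum, mul_comm]
    gcongr
    exact hgeom _
  have hexp : ∑ j, exp (-l j) ≤ 4 * N := by
    have he2 : exp (-2) ≤ 1 / 4 := by
      have h1 := exp_neg_one_lt_d9
      have h2 : exp (-2) = exp (-1) * exp (-1) := by rw [← exp_add]; norm_num
      rw [h2]
      have h3 : exp (-1) ≤ 1 / 2 := by norm_num at h1 ⊢; linarith
      nlinarith [exp_pos (-1)]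
    have hlevel (k : ℕ) :
        ∑ i : Fin (N * 2 ^ k + 1), exp (-(1 + 2 * (k : ℝ))) ≤ 2 * N * (1 / 2) ^ k := by
      have : exp (-(1 + 2 * (k : ℝ))) ≤ (1 / 4) ^ k := by
        calc exp (-(1 + 2 * (k : ℝ))) ≤ exp (k * (-2)) := exp_le_exp.2 (by linarith)
          _ = exp (-2) ^ k := exp_nat_mul _ _
          _ ≤ _ := by gcongr
      rw [Finset.sum_const, nsmul_eq_mul, Finset.card_univ, Fintype.card_fin]
      calc ((N * 2 ^ k + 1 : ℕ) : ℝ) * exp (-(1 + 2 * (k : ℝ)))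
          ≤ (2 * (N : ℝ) * 2 ^ k) * (1 / 4 : ℝ) ^ k :=
            mul_le_mul (hcount k) this (exp_pos _).le (by positivity)
        _ = 2 * (N : ℝ) * (2 * (1 / 4)) ^ k := by rw [mul_pow]; ring
        _ = _ := by norm_num
    rw [Fintype.sum_sigma, Fin.sum_univ_eq_sum_range (fun k => ∑ i : Fin (N * 2 ^ k + 1),
      exp (-(1 + 2 * (k : ℝ))))]
    refine (Finset.sum_le_sum fun k _ => hlevel k).trans ?_
    rw [← Finset.mul_sum]
    have := hgeom (n + 1)
    nlinarith
  have hl : ∀ j, 1 ≤ l j := fun j => by simp [l]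
  have hmain := exp_neg_le_prod_measureReal_eq P hc l hl (fun j => (hmom j.1 j.2).1) _ hmean
  refine le_trans (exp_le_exp.2 ?_) (hmain.trans (measureReal_mono fun q hq => ?_))
  · nlinarith
  · have hq' : ∀ k ≤ n, ∀ i ≤ N * 2 ^ k, dyadicCode W ε k i q.1 = dyadicCode W ε k i q.2 :=
      fun k hk i hi => congrFun hq ⟨⟨k, by omega⟩, ⟨i, by simp; omega⟩⟩
    intro k hk i hi
    refine (abs_sub_le_sum_of_dyadicCode_eq hε hq' k hk i hi).trans ?_
    simp only [ε]
    rw [← Finset.mul_sum, mul_assoc]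
    refine mul_le_of_le_one_right hδ.le ?_
    rw [mul_comm, ← le_div_iff₀ hr', one_div, ← tsum_geometric_of_lt_one hr0.le hr1]
    exact (summable_geometric_of_lt_one hr0.le hr1).sum_le_tsum _ fun _ _ => by positivity

lemma integral_abs_pow_gaussianReal (v : NNReal) (p : ℕ) :
    ∫ x, |x| ^ p ∂gaussianReal 0 v = √v ^ p * ∫ x, |x| ^ p ∂gaussianReal 0 1 := by
  have h : gaussianReal 0 v = (gaussianReal 0 1).map (√v * ·) := by
    rw [gaussianReal_map_const_mul]
    congr 1
    · simp
    · ext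
      simp
  rw [h, integral_map (by fun_prop) (by fun_prop), ← integral_const_mul]
  congr 1
  ext x
  rw [abs_mul, abs_of_nonneg (sqrt_nonneg _), mul_pow]

section GaussianVectors

variable {Ω : Type*} [MeasurableSpace Ω] {P : Measure Ω} {X : ℝ → Ω → ℝ}

lemma exists_map_sum_eq_gaussianReal {ι : Type*} [Fintype ι]
    (hG : ∀ (n : ℕ) (t : Fin n → ℝ) (c : Fin n → ℝ),
      ∃ v : NNReal, P.map (fun ω => ∑ i, c i * X (t i) ω) = gaussianReal 0 v) (t c : ι → ℝ) :
    ∃ v : NNReal, P.map (fun ω => ∑ i, c i * X (t i) ω) = gaussianReal 0 v := by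
  obtain ⟨v, hv⟩ := hG (Fintype.card ι) (t ∘ (Fintype.equivFin ι).symm)
    (c ∘ (Fintype.equivFin ι).symm)
  refine ⟨v, hv ▸ ?_⟩
  congr 1
  ext ω
  exact ((Fintype.equivFin ι).symm.sum_comp (fun i => c i * X (t i) ω)).symm

lemma exists_map_eq_gaussianReal
    (hG : ∀ (n : ℕ) (t : Fin n → ℝ) (c : Fin n → ℝ),
      ∃ v : NNReal, P.map (fun ω => ∑ i, c i * X (t i) ω) = gaussianReal 0 v) (t : ℝ) :
    ∃ v : NNReal, P.map (X t) = gaussianReal 0 v := by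
  simpa using hG 1 (fun _ => t) (fun _ => 1)

lemma map_strongDual_eq {ι : Type*} [Fintype ι] [DecidableEq ι]
    (hX : ∀ t, Measurable (X t)) (t : ι → ℝ)
    (L : StrongDual ℝ (ι → ℝ)) :
    (P.map fun ω i => X (t i) ω).map L
      = P.map fun ω => ∑ i, L (Pi.single i 1) * X (t i) ω := by
  rw [Measure.map_map (by fun_prop) (by fun_prop)]
  congr 1
  ext ω
  simp only [Function.comp_apply]
  conv_lhs => rw [← Finset.univ_sum_single (fun i => X (t i) ω)]
  rw [map_sum]
  refine Finset.sum_congr rfl fun i _ => ?_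
  rw [mul_comm, ← smul_eq_mul, ← map_smul, ← Pi.single_smul]
  simp

lemma aemeasurable_of_map_sum_eq_gaussianReal
    (hG : ∀ (n : ℕ) (t : Fin n → ℝ) (c : Fin n → ℝ),
      ∃ v : NNReal, P.map (fun ω => ∑ i, c i * X (t i) ω) = gaussianReal 0 v) (t : ℝ) :
    AEMeasurable (X t) P := by
  obtain ⟨v, hv⟩ := exists_map_eq_gaussianReal hG t
  refine aemeasurable_of_map_neZero ?_
  rw [hv]
  infer_instance

variable (hX : ∀ t, Measurable (X t))
  (hG : ∀ (n : ℕ) (t : Fin n → ℝ) (c : Fin n → ℝ),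
      ∃ v : NNReal, P.map (fun ω => ∑ i, c i * X (t i) ω) = gaussianReal 0 v)

include hX hG

lemma map_sub_eq_gaussianReal (s t : ℝ) :
    P.map (fun ω => X s ω - X t ω)
      = gaussianReal 0 (∫ ω, (X s ω - X t ω) ^ 2 ∂P).toNNReal := by
  obtain ⟨v, hv⟩ := hG 2 ![s, t] ![1, -1]
  have hv' : P.map (fun ω => X s ω - X t ω) = gaussianReal 0 v := by
    simpa [sub_eq_add_neg] using hv
  have h := integral_map (μ := P) (φ := fun ω => X s ω - X t ω) (f := fun x => x ^ 2)
    (by fun_prop) (by fun_prop)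
  have h2 : ∫ x, x ^ 2 ∂gaussianReal 0 v = v := by
    have := variance_of_integral_eq_zero (X := id) (μ := gaussianReal 0 v) (by fun_prop) (by simp)
    simpa using this.symm
  rw [hv', h2] at h
  rw [hv', ← h, Real.toNNReal_coe]

lemma memLp_of_map_sum_eq_gaussianReal (t : ℝ) (p : NNReal) : MemLp (X t) p P := by
  obtain ⟨v, hv⟩ := exists_map_eq_gaussianReal hG t
  have h := memLp_id_gaussianReal (μ := 0) (v := v) p
  rw [← hv] at h
  exact h.comp_of_map (hX t).aemeasurable

lemma isGaussian_map_of_map_sum_eq_gaussianReal {ι : Type*} [Fintype ι] (t : ι → ℝ) :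
    IsGaussian (P.map fun ω i => X (t i) ω) := by
  classical
  refine isGaussian_of_isGaussian_map fun L => ?_
  obtain ⟨v, hv⟩ := exists_map_sum_eq_gaussianReal hG t fun i => L (Pi.single i 1)
  rw [map_strongDual_eq hX, hv]
  infer_instance

lemma integral_strongDual_map {ι : Type*} [Fintype ι] (t : ι → ℝ)
    (L : StrongDual ℝ (ι → ℝ)) : (P.map fun ω i => X (t i) ω)[L] = 0 := by
  classical
  obtain ⟨v, hv⟩ := exists_map_sum_eq_gaussianReal hG t fun i => L (Pi.single i 1)
  have h := integral_map (μ := P.map fun ω i => X (t i) ω) (φ := L) (f := id)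
    (by fun_prop) (by fun_prop)
  rw [map_strongDual_eq hX, hv] at h
  simpa using h.symm

lemma integral_abs_sub_pow (s t : ℝ) (p : ℕ) :
    ∫ ω, |X s ω - X t ω| ^ p ∂P
      = √(∫ ω, (X s ω - X t ω) ^ 2 ∂P) ^ p * ∫ x, |x| ^ p ∂gaussianReal 0 1 := by
  have h := integral_map (μ := P) (φ := fun ω => X s ω - X t ω) (f := fun x => |x| ^ p)
    (by fun_prop) (by fun_prop)
  rw [← h, map_sub_eq_gaussianReal hX hG, integral_abs_pow_gaussianReal,
    Real.coe_toNNReal _ (integral_nonneg fun ω => sq_nonneg _)]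

lemma integrable_mul_of_map_sum_eq_gaussianReal (s t : ℝ) :
    Integrable (fun ω => X s ω * X t ω) P :=
  MemLp.integrable_mul (p := 2) (q := 2) (memLp_of_map_sum_eq_gaussianReal hX hG s 2)
    (memLp_of_map_sum_eq_gaussianReal hX hG t 2)

lemma exp_mul_measureReal_abs_le_le {ι κ : Type*} [Fintype ι] [Fintype κ] (t : ι → ℝ)
    (s w : κ → ℝ) (δ : ℝ) :
    exp (-(∑ j, ∑ k, w j * w k * ∫ ω, X (s j) ω * X (s k) ω ∂P) / 2) *
        P.real {ω | ∀ i, |X (t i) ω| ≤ δ}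
      ≤ P.real {ω | ∀ i, |X (t i) ω - ∑ j, w j * ∫ ω', X (s j) ω' * X (t i) ω' ∂P| ≤ δ} := by
  classical
  set τ : ι ⊕ κ → ℝ := Sum.elim t s
  have := isGaussian_map_of_map_sum_eq_gaussianReal hX hG τ
  have hY : Measurable fun ω i => X (τ i) ω := by fun_prop
  set l : StrongDual ℝ (ι ⊕ κ → ℝ) := ∑ j, w j • ContinuousLinearMap.proj (Sum.inr j) with hl
  set m : ι ⊕ κ → ℝ := fun i => ∑ j, w j * ∫ ω, X (s j) ω * X (τ i) ω ∂P with hm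
  have hlx (x : ι ⊕ κ → ℝ) : l x = ∑ j, w j * x (Sum.inr j) := by
    simp [hl]
  have hB : MeasurableSet {x : ι ⊕ κ → ℝ | ∀ i, |x (Sum.inl i)| ≤ δ} := by
    simp only [ofPred_forall]
    exact MeasurableSet.iInter fun i => measurableSet_le (by fun_prop) (by fun_prop)
  have hlm (L : StrongDual ℝ (ι ⊕ κ → ℝ)) :
      ∫ x, l x * L x ∂(P.map fun ω i => X (τ i) ω) = L m := by
    obtain ⟨e, he⟩ : ∃ e : ι ⊕ κ → ℝ, ∀ x, L x = ∑ i, x i * e i := by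
      refine ⟨fun i => L (Pi.single i 1), fun x => ?_⟩
      conv_lhs => rw [← Finset.univ_sum_single x]
      rw [map_sum]
      refine Finset.sum_congr rfl fun i _ => ?_
      rw [← smul_eq_mul, ← map_smul, ← Pi.single_smul]
      simp
    rw [integral_map hY.aemeasurable (by fun_prop)]
    simp_rw [hlx, he, Finset.sum_mul_sum]
    have hint (j : κ) (i : ι ⊕ κ) : Integrable (fun ω => w j * X (τ (Sum.inr j)) ω *
        (X (τ i) ω * e i)) P := by
      refine ((integrable_mul_of_map_sum_eq_gaussianReal hX hG (s j) (τ i)).const_mul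
        (w j * e i)).congr (.of_forall fun ω => ?_)
      simp [τ]
      ring
    rw [integral_finsetSum _ fun j _ => integrable_finsetSum _ fun i _ => hint j i]
    simp_rw [integral_finsetSum _ fun i _ => hint _ i, hm, Finset.sum_mul]
    rw [Finset.sum_comm]
    refine Finset.sum_congr rfl fun i _ => Finset.sum_congr rfl fun j _ => ?_
    rw [mul_right_comm, ← integral_const_mul]
    congr 1
    ext ω
    simp [τ]
    ring
  have h := exp_mul_measureReal_le_measureReal_sub_mem (integral_strongDual_map hX hG τ) l m hlm hB
    (by simp)
  rw [map_measureReal_apply hY hB,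
    map_measureReal_apply hY (by exact hB.preimage (by fun_prop))] at h
  have hm' : l m = ∑ j, ∑ k, w j * w k * ∫ ω, X (s j) ω * X (s k) ω ∂P := by
    rw [hlx]
    simp only [hm, Finset.mul_sum]
    refine Finset.sum_congr rfl fun j _ => Finset.sum_congr rfl fun k _ => ?_
    simp only [τ, Sum.elim_inr, mul_assoc]
    congr 3
    ext ω
    ring
  rw [hm'] at h
  exact h

variable [IsProbabilityMeasure P]

lemma integrable_abs_sub_pow (s t : ℝ) (p : ℕ) :
    Integrable (fun ω => |X s ω - X t ω| ^ p) P := by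
  have h := ((memLp_of_map_sum_eq_gaussianReal hX hG s p).sub
    (memLp_of_map_sum_eq_gaussianReal hX hG t p))
  simpa using h.integrable_norm_pow'

lemma measureReal_forall_abs_le_eq {ι : Type*} [Fintype ι] (t : ι → ℝ) (δ : ℝ) :
    P.real {ω | ∀ i, |X (t i) ω| ≤ δ}
      = (P.prod P).real {q | ∀ i, |X (t i) q.1 - X (t i) q.2| ≤ √2 * δ} := by
  have := isGaussian_map_of_map_sum_eq_gaussianReal hX hG t
  have hY : Measurable fun ω i => X (t i) ω := by fun_prop
  have hB : MeasurableSet {x : ι → ℝ | ∀ i, |x i| ≤ δ} := by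
    simp only [ofPred_forall]
    exact MeasurableSet.iInter fun i => measurableSet_le (by fun_prop) (by fun_prop)
  have h := prod_measureReal_sub_mem (integral_strongDual_map hX hG t) hB
  rw [Measure.map_prod_map _ _ hY hY,
    map_measureReal_apply (by fun_prop) (by exact hB.preimage (by fun_prop)),
    map_measureReal_apply hY hB] at h
  rw [show {ω | ∀ i, |X (t i) ω| ≤ δ} = (fun ω i => X (t i) ω) ⁻¹' {x | ∀ i, |x i| ≤ δ} from rfl,
    ← h]
  congr 1
  ext q
  simp [abs_mul, inv_mul_le_iff₀, abs_of_nonneg]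

end GaussianVectors

lemma integral_sub_sq_le {Ω : Type*} [MeasurableSpace Ω] {P : Measure Ω} [IsProbabilityMeasure P]
    {X : ℝ → Ω → ℝ} {α : ℝ} (hα : 0 < α) (hX : ∀ t, Measurable (X t))
    (hG : ∀ (n : ℕ) (t : Fin n → ℝ) (c : Fin n → ℝ),
      ∃ v : NNReal, P.map (fun ω => ∑ i, c i * X (t i) ω) = gaussianReal 0 v)
    (hcov : ∀ s t : ℝ, (∫ ω, X s ω * X t ω ∂P) = exp (-(|t - s| ^ α))) (s t : ℝ) :
    ∫ ω, (X s ω - X t ω) ^ 2 ∂P ≤ 2 * |t - s| ^ α := by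
  have hi := integrable_mul_of_map_sum_eq_gaussianReal hX hG
  have h : ∫ ω, (X s ω - X t ω) ^ 2 ∂P = 2 - 2 * exp (-(|t - s| ^ α)) := by
    calc ∫ ω, (X s ω - X t ω) ^ 2 ∂P
        = ∫ ω, (X s ω * X s ω + X t ω * X t ω - 2 * (X s ω * X t ω)) ∂P := by
          congr 1
          ext ω
          ring
      _ = _ := by
          have hadd : Integrable (fun ω => X s ω * X s ω + X t ω * X t ω) P := (hi s s).add (hi t t)
          rw [integral_sub hadd ((hi s t).const_mul 2),
            integral_add (hi s s) (hi t t), integral_const_mul, hcov, hcov, hcov]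
          simp [zero_rpow hα.ne']
          norm_num
  rw [h]
  linarith [add_one_le_exp (-(|t - s| ^ α))]

/-- Small ball estimate, uniform over the dyadic refinements of an equidistant partition. -/
lemma exists_exp_neg_mul_le_measureReal_abs_le {Ω : Type*} [MeasurableSpace Ω] {P : Measure Ω}
    [IsProbabilityMeasure P] {X : ℝ → Ω → ℝ} {α : ℝ} (hα : 0 < α) (hα1 : α ≤ 1)
    (hX : ∀ t, Measurable (X t))
    (hG : ∀ (n : ℕ) (t : Fin n → ℝ) (c : Fin n → ℝ),
      ∃ v : NNReal, P.map (fun ω => ∑ i, c i * X (t i) ω) = gaussianReal 0 v)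
    (hcov : ∀ s t : ℝ, (∫ ω, X s ω * X t ω ∂P) = exp (-(|t - s| ^ α)))
    (a : ℝ) {L : ℝ} (hL : 0 < L) :
    ∃ C : ℝ, ∀ N : ℕ, 1 ≤ N → ∀ n : ℕ, exp (-(C * N)) ≤
      P.real {ω | ∀ j : Σ k : Fin (n + 1), Fin (N * 2 ^ (k : ℕ) + 1),
        |X (a + L * (j.2 : ℕ) / (N * 2 ^ (j.1 : ℕ))) ω| ≤ (L / N) ^ (α / 2)} := by
  set r : ℝ := 2 ^ (-(α / 4)) with hr
  have hr0 : 0 < r := by positivity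
  have hr1 : r < 1 := rpow_lt_one_of_one_lt_of_neg (by norm_num) (by linarith)
  obtain ⟨p, hp⟩ := exists_pow_lt_of_lt_one (show (0 : ℝ) < 1 / 8 by norm_num) hr1
  have hp1 : 1 ≤ p := by
    by_contra! h
    obtain rfl : p = 0 := by omega
    norm_num at hp
  set M : ℕ → ℝ := fun q => ∫ x, |x| ^ q ∂gaussianReal 0 1
  have hM (q : ℕ) : 0 ≤ M q := integral_nonneg fun x => by positivity
  have hmom {s t d : ℝ} (hst : |t - s| ≤ d) (q : ℕ) :
      ∫ ω, |X s ω - X t ω| ^ q ∂P ≤ √2 ^ q * M q * (d ^ (α / 2)) ^ q := by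
    have hd : 0 ≤ d := (abs_nonneg _).trans hst
    have h1 : √(∫ ω, (X s ω - X t ω) ^ 2 ∂P) ≤ √2 * d ^ (α / 2) := by
      rw [sqrt_le_left (by positivity), mul_pow, sq_sqrt (by norm_num), ← rpow_mul_natCast hd]
      refine (integral_sub_sq_le hα hX hG hcov s t).trans ?_
      norm_num
      gcongr
    rw [integral_abs_sub_pow hX hG, mul_right_comm, ← mul_pow]
    gcongr
  set K : ℝ := ∫ ω, |X a ω| ∂P
  have hK : 0 ≤ K := integral_nonneg fun ω => abs_nonneg _
  set A : ℝ := K / L ^ (α / 2) + √2 * M 1 + √2 ^ p * M p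
  have hA1 : 0 ≤ K / L ^ (α / 2) := by positivity
  have hA2 : 0 ≤ √2 * M 1 := mul_nonneg (sqrt_nonneg _) (hM 1)
  have hA3 : 0 ≤ √2 ^ p * M p := mul_nonneg (by positivity) (hM p)
  obtain ⟨C, hC⟩ := exists_exp_neg_mul_le_prod_measureReal_abs_sub_le (A := A) hr0 hr1 hp1 hp.le
    (by positivity)
  refine ⟨C, fun N hN n => ?_⟩
  have hN0 : (0 : ℝ) < N := by exact_mod_cast hN
  have hN1 : (1 : ℝ) ≤ N := by exact_mod_cast hN
  set δ : ℝ := (L / N) ^ (α / 2)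
  have hδ : 0 < δ := by positivity
  set τ : ℕ → ℕ → ℝ := fun k i => a + L * i / (N * 2 ^ k)
  have hint (s t : ℝ) : Integrable (fun ω => X s ω - X t ω) P :=
    ((memLp_of_map_sum_eq_gaussianReal hX hG s 1).sub
      (memLp_of_map_sum_eq_gaussianReal hX hG t 1)).integrable (by simp)
  have hτ1 (i : ℕ) : |τ 0 i - τ 0 (i + 1)| ≤ L / N := by
    simp only [τ]
    rw [abs_sub_comm, abs_of_nonneg] <;> push_cast <;> ring_nf
    · rfl
    · positivity
  have hτ2 (k i : ℕ) : |τ k (i / 2) - τ (k + 1) i| ≤ L / N * (1 / 2) ^ (k + 1) := by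
    have h1 : τ k (i / 2) - τ (k + 1) i = -(L / N * (1 / 2) ^ (k + 1) * ((i % 2 : ℕ) : ℝ)) := by
      have h2 : (i : ℝ) = 2 * ((i / 2 : ℕ) : ℝ) + ((i % 2 : ℕ) : ℝ) := by
        exact_mod_cast (Nat.div_add_mod i 2).symm
      simp only [τ]
      rw [h2, one_div, inv_pow]
      field_simp
      ring
    have h3 : ((i % 2 : ℕ) : ℝ) ≤ 1 := by exact_mod_cast Nat.lt_succ_iff.1 (Nat.mod_lt i two_pos)
    rw [h1, abs_neg, abs_of_nonneg (by positivity)]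
    exact mul_le_of_le_one_right (by positivity) h3
  have hscale (k : ℕ) : (L / N * (1 / 2) ^ (k + 1)) ^ (α / 2) = δ * r ^ (2 * (k + 1)) := by
    rw [mul_rpow (by positivity) (by positivity)]
    congr 1
    rw [hr, one_div, inv_pow, inv_rpow (by positivity), ← rpow_natCast, ← rpow_natCast,
      ← rpow_mul (by norm_num), ← rpow_mul (by norm_num), ← rpow_neg (by norm_num)]
    congr 1
    push_cast
    ring
  have hchain := hC P (fun k i => X (τ k i)) (fun k i => hX _) N hN δ hδ ?_ ?_
    (fun i => hint _ _) ?_ (fun k i => integrable_abs_sub_pow hX hG _ _ p) ?_ n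
  · refine hchain.trans ?_
    rw [measureReal_forall_abs_le_eq hX hG]
    refine measureReal_mono fun q hq j => ?_
    refine (hq j.1 (by omega) j.2 (by omega)).trans ?_
    have : 1 ≤ √2 := by rw [one_le_sqrt]; norm_num
    nlinarith
  · exact (memLp_of_map_sum_eq_gaussianReal hX hG _ 1).integrable (by simp)
  · have h1 : τ 0 0 = a := by simp [τ]
    rw [h1]
    have h2 : L ^ (α / 2) ≤ N * δ := by
      simp only [δ]
      rw [div_rpow hL.le hN0.le, ← mul_div_assoc, le_div_iff₀ (by positivity), mul_comm]
      gcongr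
      calc (N : ℝ) ^ (α / 2) ≤ N ^ (1 : ℝ) := rpow_le_rpow_of_exponent_le hN1 (by linarith)
        _ = N := rpow_one _
    calc K = K / L ^ (α / 2) * L ^ (α / 2) := by field_simp
      _ ≤ A * (N * δ) := by
        gcongr
        simp only [A]
        linarith
      _ = A * N * δ := by ring
  · intro i
    have h := hmom (hτ1 i) 1
    simp only [pow_one] at h
    refine h.trans ?_
    gcongr
    simp only [A]
    linarith
  · intro k i
    refine (hmom (hτ2 k i) p).trans ?_
    rw [hscale]
    gcongr
    simp only [A]
    linarith

section Energy

variable {R : ℝ → ℝ}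

lemma statEnergy_eq_integral_prod (hR : Continuous R) (hR0 : ∀ t, 0 ≤ R t) (hR1 : ∀ t, R t ≤ 1)
    (ν : Measure ℝ) [IsFiniteMeasure ν] :
    Integrable (fun p : ℝ × ℝ => R (p.2 - p.1)) (ν.prod ν) ∧
      statEnergy R ν = ∫ p, R (p.2 - p.1) ∂(ν.prod ν) := by
  have hi : Integrable (fun p : ℝ × ℝ => R (p.2 - p.1)) (ν.prod ν) :=
    Integrable.of_bound (by fun_prop) 1 (.of_forall fun p => by
      rw [norm_eq_abs, abs_of_nonneg (hR0 _)]
      exact hR1 _)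
  exact ⟨hi, (integral_prod _ hi).symm⟩

lemma ae_prod_mem_Icc {a b : ℝ} {ν : Measure ℝ} [SFinite ν] (hν : ν (Icc a b)ᶜ = 0) :
    ∀ᵐ p ∂(ν.prod ν), p.1 ∈ Icc a b ∧ p.2 ∈ Icc a b := by
  have h : ∀ᵐ t ∂ν, t ∈ Icc a b := hν
  exact (Measure.quasiMeasurePreserving_fst.ae h).and (Measure.quasiMeasurePreserving_snd.ae h)

lemma statEnergy_nonneg (hR0 : ∀ t, 0 ≤ R t) (ν : Measure ℝ) : 0 ≤ statEnergy R ν :=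
  integral_nonneg fun _ => integral_nonneg fun _ => hR0 _

lemma statEnergy_sum_dirac {κ : Type*} [Fintype κ] {q s : κ → ℝ} (hq : ∀ j, 0 ≤ q j) :
    statEnergy R (∑ j, ENNReal.ofReal (q j) • Measure.dirac (s j))
      = ∑ i, ∑ j, q i * q j * R (s j - s i) := by
  have hint (f : ℝ → ℝ) : ∫ t, f t ∂(∑ j, ENNReal.ofReal (q j) • Measure.dirac (s j))
      = ∑ j, q j * f (s j) := by
    rw [integral_finsetSum_measure fun j _ =>
      (integrable_dirac (by simp)).smul_measure ENNReal.ofReal_ne_top]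
    refine Finset.sum_congr rfl fun j _ => ?_
    rw [integral_smul_measure, integral_dirac, ENNReal.toReal_ofReal (hq j), smul_eq_mul]
  simp_rw [statEnergy, hint, Finset.mul_sum, mul_assoc]

/-- The set of energies of probability measures carried by `[a, b]`. -/
def energySet (R : ℝ → ℝ) (a b : ℝ) : Set ℝ :=
  {x : ℝ | ∃ ν : Measure ℝ, IsProbabilityMeasure ν ∧ ν (Icc a b)ᶜ = 0 ∧ x = statEnergy R ν}

lemma energySet_nonempty {a b : ℝ} (hab : a ≤ b) : (energySet R a b).Nonempty :=
  ⟨_, Measure.dirac a, inferInstance, by simp [hab], rfl⟩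

lemma bddBelow_energySet (hR0 : ∀ t, 0 ≤ R t) (a b : ℝ) : BddBelow (energySet R a b) := by
  refine ⟨0, ?_⟩
  rintro _ ⟨ν, -, -, rfl⟩
  exact statEnergy_nonneg hR0 ν

lemma le_sInf_energySet (hR : Continuous R) (hR0 : ∀ t, 0 ≤ R t) (hR1 : ∀ t, R t ≤ 1) {a b m : ℝ}
    (hab : a ≤ b) (hm : ∀ t, |t| ≤ b - a → m ≤ R t) : m ≤ sInf (energySet R a b) := by
  refine le_csInf (energySet_nonempty hab) ?_
  rintro _ ⟨ν, hν, hν0, rfl⟩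
  obtain ⟨hi, he⟩ := statEnergy_eq_integral_prod hR hR0 hR1 ν
  rw [he]
  have h := integral_mono_ae (integrable_const m) hi (by
    filter_upwards [ae_prod_mem_Icc hν0] with p hp
    refine hm _ (abs_le.2 ⟨?_, ?_⟩) <;> linarith [hp.1.1, hp.1.2, hp.2.1, hp.2.2])
  simpa using h

lemma sInf_energySet_le_sum (hR0 : ∀ t, 0 ≤ R t) {a b : ℝ} {κ : Type*} [Fintype κ] {q s : κ → ℝ}
    (hs : ∀ j, s j ∈ Icc a b) (hq : ∀ j, 0 ≤ q j) (hq1 : ∑ j, q j = 1) :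
    sInf (energySet R a b) ≤ ∑ i, ∑ j, q i * q j * R (s j - s i) := by
  refine csInf_le (bddBelow_energySet hR0 a b)
    ⟨∑ j, ENNReal.ofReal (q j) • Measure.dirac (s j), ⟨?_⟩, ?_, (statEnergy_sum_dirac hq).symm⟩
  · simp [← ENNReal.ofReal_sum_of_nonneg fun j _ => hq j, hq1]
  · simp only [Measure.coe_finsetSum, Finset.sum_apply, Measure.smul_apply, smul_eq_mul]
    refine Finset.sum_eq_zero fun j _ => ?_
    simp [Measure.dirac_apply' _ measurableSet_Icc.compl, hs j]

lemma sInf_energySet_le_one (hR0 : ∀ t, 0 ≤ R t) (hR1 : ∀ t, R t ≤ 1) {a b : ℝ} (hab : a ≤ b) :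
    sInf (energySet R a b) ≤ 1 := by
  refine (sInf_energySet_le_sum (κ := Unit) (q := fun _ => 1) (s := fun _ => a) hR0
    (by simp [hab]) (by simp) (by simp)).trans ?_
  simpa using hR1 0

/-- Discretisation: the minimal energy is approached by finitely supported measures. -/
lemma exists_sum_lt_of_sInf_energySet_lt (hR : Continuous R) (hR0 : ∀ t, 0 ≤ R t)
    (hR1 : ∀ t, R t ≤ 1) {a b e : ℝ} (hab : a < b) (he : sInf (energySet R a b) < e) :
    ∃ (n : ℕ) (q s : Fin (n + 1) → ℝ), (∀ j, s j ∈ Icc a b) ∧ (∀ j, 0 ≤ q j) ∧ ∑ j, q j = 1 ∧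
      ∑ i, ∑ j, q i * q j * R (s j - s i) ≤ e := by
  obtain ⟨_, ⟨ν, hν, hν0, rfl⟩, hlt⟩ := exists_lt_of_csInf_lt (energySet_nonempty hab.le) he
  set L := b - a
  have hL : 0 < L := sub_pos.2 hab
  have huc : UniformContinuousOn R (Icc (-L) L) :=
    isCompact_Icc.uniformContinuousOn_of_continuous hR.continuousOn
  obtain ⟨η, hη, hRη⟩ := Metric.uniformContinuousOn_iff_le.1 huc _ (sub_pos.2 hlt)
  obtain ⟨n, hn⟩ := exists_nat_gt (2 * L / η)
  have hn0 : (0 : ℝ) < n := lt_trans (by positivity) hn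
  have hnη : 2 * (L / n) ≤ η := by
    rw [div_lt_iff₀ hη] at hn
    rw [← mul_div_assoc, div_le_iff₀ hn0]
    linarith
  set s : Fin (n + 1) → ℝ := fun j => a + L * (j : ℕ) / n with hs_def
  set g : ℝ → Fin (n + 1) := fun t => Fin.ofNat (n + 1) ⌊n * (t - a) / L⌋₊ with hg_def
  have hg : Measurable g :=
    (measurable_from_top (f := fun m : ℕ => Fin.ofNat (n + 1) m)).comp
      (Nat.measurable_floor.comp (by fun_prop : Measurable fun t : ℝ => n * (t - a) / L))
  have hs (j) : s j ∈ Icc a b := by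
    have hj : ((j : ℕ) : ℝ) ≤ n := by exact_mod_cast Nat.lt_succ_iff.1 j.2
    have h1 : L * (j : ℕ) / n ≤ L := by
      rw [div_le_iff₀ hn0]
      gcongr
    have h2 : 0 ≤ L * (j : ℕ) / n := by positivity
    simp only [s, mem_Icc]
    constructor <;> linarith
  have hsg {t : ℝ} (ht : t ∈ Icc a b) : t - L / n ≤ s (g t) ∧ s (g t) ≤ t := by
    have h0 : 0 ≤ n * (t - a) / L := by
      have := sub_nonneg.2 ht.1
      positivity
    have hle : n * (t - a) / L ≤ n := by
      rw [div_le_iff₀ hL]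
      gcongr
      linarith [ht.2]
    have hval : (g t : ℕ) = ⌊n * (t - a) / L⌋₊ := by
      simp only [hg_def, Fin.ofNat]
      refine Nat.mod_eq_of_lt (Nat.lt_succ_iff.2 ?_)
      exact_mod_cast (Nat.floor_le h0).trans hle
    have h1 := Nat.floor_le h0
    have h2 := Nat.lt_floor_add_one (n * (t - a) / L)
    simp only [hs_def]
    rw [hval]
    have e1 : L * (n * (t - a) / L) / n = t - a := by field_simp
    have h3 : L * (⌊n * (t - a) / L⌋₊ : ℝ) / n ≤ L * (n * (t - a) / L) / n := by gcongr
    have h4 : L * (n * (t - a) / L) / n ≤ L * ((⌊n * (t - a) / L⌋₊ : ℝ) + 1) / n := by gcongr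
    rw [mul_add, mul_one, add_div] at h4
    constructor <;> linarith
  set ρ := ν.map g
  have hρ : IsProbabilityMeasure ρ := Measure.isProbabilityMeasure_map hg.aemeasurable
  obtain ⟨hi, hE⟩ := statEnergy_eq_integral_prod hR hR0 hR1 ν
  refine ⟨n, fun j => ρ.real {j}, s, hs, fun j => measureReal_nonneg, ?_, ?_⟩
  · simp
  · have h1 : ∑ i, ∑ j, ρ.real {i} * ρ.real {j} * R (s j - s i)
        = ∫ p, R (s (g p.2) - s (g p.1)) ∂(ν.prod ν) := by
      calc _ = ∫ p, R (s p.2 - s p.1) ∂(ρ.prod ρ) := by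
            rw [integral_prod _ .of_finite, integral_fintype .of_finite]
            refine Finset.sum_congr rfl fun i _ => ?_
            rw [integral_fintype .of_finite, smul_eq_mul, Finset.mul_sum]
            simp [mul_assoc]
        _ = _ := by
            simp only [ρ]
            rw [Measure.map_prod_map _ _ hg hg,
              integral_map (hg.prodMap hg).aemeasurable (by fun_prop)]
            rfl
    rw [h1]
    have hig : Integrable (fun p : ℝ × ℝ => R (s (g p.2) - s (g p.1))) (ν.prod ν) := by
      refine Integrable.of_bound ?_ 1 (.of_forall fun p => ?_)
      · have hsm : Measurable fun t => s (g t) := (measurable_from_top (f := s)).comp hg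
        exact (hR.measurable.comp ((hsm.comp measurable_snd).sub
          (hsm.comp measurable_fst))).aestronglyMeasurable
      · rw [norm_eq_abs, abs_of_nonneg (hR0 _)]
        exact hR1 _
    have h2 := integral_mono_ae hig (hi.add (integrable_const (e - statEnergy R ν))) (by
      filter_upwards [ae_prod_mem_Icc hν0] with p hp
      have hp1 := hsg hp.1
      have hp2 := hsg hp.2
      have hb1 := hs (g p.1)
      have hb2 := hs (g p.2)
      have hb3 := hp.1
      have hb4 := hp.2
      simp only [mem_Icc] at hb1 hb2 hb3 hb4
      have h := hRη (s (g p.2) - s (g p.1)) ⟨by simp only [L]; linarith, by simp only [L]; linarith⟩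
        (p.2 - p.1) ⟨by simp only [L]; linarith, by simp only [L]; linarith⟩ (by
          rw [Real.dist_eq]
          refine le_trans (abs_le.2 ⟨?_, ?_⟩) hnη <;> linarith)
      rw [Real.dist_eq] at h
      simp only [Pi.add_apply]
      linarith [(abs_le.1 h).2])
    refine h2.trans (le_of_eq ?_)
    rw [integral_add' hi (integrable_const _), ← hE]
    simp

/-- Finitely supported near-minimisers of the energy have potential almost bounded below by the
minimal energy. -/
lemma exists_weights_potential_ge (hR : Continuous R) (hR0 : ∀ t, 0 ≤ R t) (hR1 : ∀ t, R t ≤ 1)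
    (hReven : ∀ t, R (-t) = R t) {a b ε : ℝ} (hab : a < b) (hε : 0 < ε) (hε2 : ε ≤ 1 / 2) :
    ∃ (n : ℕ) (q s : Fin (n + 1) → ℝ),
      ∑ i, ∑ j, q i * q j * R (s j - s i) ≤ sInf (energySet R a b) + ε ^ 2 ∧
      ∀ t ∈ Icc a b, sInf (energySet R a b) - 2 * ε ≤ ∑ j, q j * R (t - s j) := by
  obtain ⟨n, q, s, hs, hq, hq1, hE⟩ := exists_sum_lt_of_sInf_energySet_lt hR hR0 hR1 hab
    (lt_add_of_pos_right _ (show 0 < ε ^ 2 by positivity))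
  refine ⟨n, q, s, hE, fun t ht => ?_⟩
  set σ := sInf (energySet R a b)
  have hσ1 : σ ≤ 1 := sInf_energySet_le_one hR0 hR1 hab.le
  have h := sInf_energySet_le_sum (R := R) (κ := Option (Fin (n + 1)))
    (q := fun o => o.elim ε fun j => (1 - ε) * q j) (s := fun o => o.elim t s) hR0
    (by rintro (_ | j); exacts [ht, hs j])
    (by rintro (_ | j); exacts [hε.le, mul_nonneg (by linarith) (hq j)])
    (by simp [Fintype.sum_option, ← Finset.mul_sum, hq1])
  set c := ∑ j, q j * R (t - s j)
  have hexp : ∑ i : Option (Fin (n + 1)), ∑ j : Option (Fin (n + 1)),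
      (i.elim ε fun j => (1 - ε) * q j) * (j.elim ε fun j => (1 - ε) * q j) *
        R (j.elim t s - i.elim t s)
      = ε ^ 2 * R 0 + 2 * (ε * (1 - ε)) * c
        + (1 - ε) ^ 2 * ∑ i, ∑ j, q i * q j * R (s j - s i) := by
    simp only [Fintype.sum_option, Option.elim_none, Option.elim_some, sub_self,
      Finset.sum_add_distrib]
    have e1 : ∑ j, ε * ((1 - ε) * q j) * R (s j - t) = ε * (1 - ε) * c := by
      simp only [c, Finset.mul_sum]
      refine Finset.sum_congr rfl fun j _ => ?_
      rw [← hReven, neg_sub]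
      ring
    have e2 : ∑ j, (1 - ε) * q j * ε * R (t - s j) = ε * (1 - ε) * c := by
      simp only [c, Finset.mul_sum]
      refine Finset.sum_congr rfl fun j _ => ?_
      ring
    rw [e1, e2]
    simp only [Finset.mul_sum]
    have e3 : ∑ i, ∑ j, (1 - ε) * q i * ((1 - ε) * q j) * R (s j - s i)
        = ∑ i, ∑ j, (1 - ε) ^ 2 * (q i * q j * R (s j - s i)) :=
      Finset.sum_congr rfl fun i _ => Finset.sum_congr rfl fun j _ => by ring
    rw [e3]
    ring
  rw [hexp] at h
  have h0 := hR1 0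
  have h1 : σ ≤ ε ^ 2 + 2 * (ε * (1 - ε)) * c + (1 - ε) ^ 2 * (σ + ε ^ 2) := by
    refine h.trans ?_
    gcongr
    nlinarith [sq_nonneg ε]
  have hσ0 : 0 ≤ σ := le_sInf_energySet hR hR0 hR1 hab.le fun t _ => hR0 t
  have hε1 : 0 < ε * (1 - ε) := mul_pos hε (by linarith)
  by_contra! hlt
  have h2 : 2 * (ε * (1 - ε)) * c < 2 * (ε * (1 - ε)) * (σ - 2 * ε) := by gcongr
  have h3 : ε ^ 2 * σ ≥ 0 := by positivity
  have h5 : 0 ≤ ε ^ 2 * (1 - 2 * ε) := mul_nonneg (sq_nonneg _) (by linarith)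
  have h6 : 0 ≤ ε ^ 2 * ε * (2 - ε) := by
    have : 0 ≤ 2 - ε := by linarith
    positivity
  nlinarith

end Energy

section HighMinima

variable {Ω : Type*} [MeasurableSpace Ω] {P : Measure Ω} [IsProbabilityMeasure P]
  {X : ℝ → Ω → ℝ} {α : ℝ}

lemma continuous_exp_neg_abs_rpow (hα : 0 < α) : Continuous fun t : ℝ => exp (-(|t| ^ α)) :=
  continuous_exp.comp (continuous_abs.rpow_const fun _ => Or.inr hα.le).neg

lemma exp_neg_abs_rpow_le_one (t : ℝ) : exp (-(|t| ^ α)) ≤ 1 := by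
  rw [exp_le_one_iff, neg_nonpos]
  positivity

lemma exp_mul_exp_le_measureReal_forall_le (hα : 0 < α) (hX : ∀ t, Measurable (X t))
    (hG : ∀ (n : ℕ) (t : Fin n → ℝ) (c : Fin n → ℝ),
      ∃ v : NNReal, P.map (fun ω => ∑ i, c i * X (t i) ω) = gaussianReal 0 v)
    (hcov : ∀ s t : ℝ, (∫ ω, X s ω * X t ω ∂P) = exp (-(|t - s| ^ α)))
    {a b σ : ℝ} (hab : a < b) (hσ : σ = sInf (energySet (fun t => exp (-(|t| ^ α))) a b))
    (hσ0 : 0 < σ) {ι : Type*} [Fintype ι] {t : ι → ℝ} (ht : ∀ i, t i ∈ Icc a b) {u δ κ : ℝ}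
    (hu : 0 ≤ u) (hδ : 0 ≤ δ) (hκ0 : 0 ≤ κ)
    (hκ : κ ≤ P.real {ω | ∀ i, |X (t i) ω| ≤ δ}) :
    exp (-(u + 2 * δ) ^ 2 / (2 * σ)) * κ ≤ P.real {ω | ∀ i, u + δ ≤ X (t i) ω} := by
  have key (ε : ℝ) (hε : 0 < ε) (hε2 : ε ≤ 1 / 2) (hεσ : ε < σ / 2) :
      exp (-(((u + 2 * δ) / (σ - 2 * ε)) ^ 2 * (σ + ε ^ 2)) / 2) * κ
        ≤ P.real {ω | ∀ i, u + δ ≤ X (t i) ω} := by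
    obtain ⟨n, q, s, hE, hpot⟩ := exists_weights_potential_ge (continuous_exp_neg_abs_rpow hα)
      (fun t => (exp_pos _).le) exp_neg_abs_rpow_le_one (fun t => by simp) hab hε hε2
    rw [← hσ] at hE hpot
    have hd : 0 < σ - 2 * ε := by linarith
    set w := (u + 2 * δ) / (σ - 2 * ε)
    have hw : 0 ≤ w := by positivity
    have h := exp_mul_measureReal_abs_le_le hX hG t s (fun j => w * q j) δ
    simp_rw [hcov] at h
    have hsum : ∑ j, ∑ k, w * q j * (w * q k) * exp (-(|s k - s j| ^ α))
        = w ^ 2 * ∑ i, ∑ j, q i * q j * exp (-(|s j - s i| ^ α)) := by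
      simp only [Finset.mul_sum]
      exact Finset.sum_congr rfl fun i _ => Finset.sum_congr rfl fun j _ => by ring
    rw [hsum] at h
    calc exp (-(w ^ 2 * (σ + ε ^ 2)) / 2) * κ
        ≤ exp (-(w ^ 2 * ∑ i, ∑ j, q i * q j * exp (-(|s j - s i| ^ α))) / 2)
            * P.real {ω | ∀ i, |X (t i) ω| ≤ δ} := by gcongr
      _ ≤ _ := h
      _ ≤ _ := by
        refine measureReal_mono fun ω hω i => ?_
        have h1 := (abs_le.1 (hω i)).1
        have h2 := mul_le_mul_of_nonneg_left (hpot (t i) (ht i)) hw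
        rw [div_mul_cancel₀ _ hd.ne', Finset.mul_sum] at h2
        simp_rw [mul_assoc] at h1
        linarith
  have hcont : ContinuousAt
      (fun ε : ℝ => exp (-(((u + 2 * δ) / (σ - 2 * ε)) ^ 2 * (σ + ε ^ 2)) / 2) * κ) 0 := by
    have : σ - 2 * 0 ≠ 0 := by simpa using hσ0.ne'
    fun_prop (disch := assumption)
  have hlim := hcont.tendsto.mono_left (nhdsWithin_le_nhds (s := Ioi 0))
  have hval : -(((u + 2 * δ) / (σ - 2 * 0)) ^ 2 * (σ + 0 ^ 2)) / 2
      = -(u + 2 * δ) ^ 2 / (2 * σ) := by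
    rw [mul_zero, sub_zero, zero_pow two_ne_zero, add_zero]
    field_simp
  simp only [hval] at hlim
  refine le_of_tendsto hlim ?_
  have hmin : (0 : ℝ) < min (1 / 2) (σ / 2) := lt_min (by norm_num) (by linarith)
  filter_upwards [Ioo_mem_nhdsGT hmin] with ε hε
  exact key ε hε.1 (hε.2.le.trans (min_le_left _ _)) (hε.2.trans_le (min_le_right _ _))

/-- Lower bound for the probability of a high minimum, with a free number `N` of nodes. -/
lemma exists_exp_le_measureReal_forall_lt (hα : 0 < α) (hα1 : α ≤ 1)
    (hG : ∀ (n : ℕ) (t : Fin n → ℝ) (c : Fin n → ℝ),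
      ∃ v : NNReal, P.map (fun ω => ∑ i, c i * X (t i) ω) = gaussianReal 0 v)
    (hpath : ∀ ω, Continuous fun t => X t ω)
    (hcov : ∀ s t : ℝ, (∫ ω, X s ω * X t ω ∂P) = exp (-(|t - s| ^ α)))
    {a b σ : ℝ} (hab : a < b) (hσ : σ = sInf (energySet (fun t => exp (-(|t| ^ α))) a b))
    (hσ0 : 0 < σ) :
    ∃ C : ℝ, ∀ N : ℕ, 1 ≤ N → ∀ u : ℝ, 0 ≤ u →
      exp (-(u + 2 * ((b - a) / N) ^ (α / 2)) ^ 2 / (2 * σ) - C * N)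
        ≤ P.real {ω | ∀ t ∈ Icc a b, u < X t ω} := by
  have hae := aemeasurable_of_map_sum_eq_gaussianReal hG
  set Y : ℝ → Ω → ℝ := fun t => (hae t).mk (X t)
  have hYX (t : ℝ) : X t =ᵐ[P] Y t := (hae t).ae_eq_mk
  have hY (t : ℝ) : Measurable (Y t) := (hae t).measurable_mk
  have hGY (n : ℕ) (t : Fin n → ℝ) (c : Fin n → ℝ) :
      ∃ v : NNReal, P.map (fun ω => ∑ i, c i * Y (t i) ω) = gaussianReal 0 v := by
    obtain ⟨v, hv⟩ := hG n t c
    refine ⟨v, hv ▸ Measure.map_congr ?_⟩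
    filter_upwards [ae_all_iff.2 fun i => hYX (t i)] with ω hω
    simp_rw [hω]
  have hcovY (s t : ℝ) : (∫ ω, Y s ω * Y t ω ∂P) = exp (-(|t - s| ^ α)) := by
    rw [← hcov]
    refine integral_congr_ae ?_
    filter_upwards [hYX s, hYX t] with ω h1 h2
    rw [h1, h2]
  have hL : 0 < b - a := sub_pos.2 hab
  obtain ⟨C, hC⟩ := exists_exp_neg_mul_le_measureReal_abs_le hα hα1 hY hGY hcovY a hL
  refine ⟨C, fun N hN u hu => ?_⟩
  have hN0 : (0 : ℝ) < N := by exact_mod_cast hN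
  set δ : ℝ := ((b - a) / N) ^ (α / 2)
  have hδ : 0 < δ := by positivity
  set τ : ℕ → ℕ → ℝ := fun k i => a + (b - a) * i / (N * 2 ^ k)
  have hτ {k i : ℕ} (hi : i ≤ N * 2 ^ k) : τ k i ∈ Icc a b := by
    have hi' : (i : ℝ) ≤ N * 2 ^ k := by exact_mod_cast hi
    have h1 : (b - a) * i / (N * 2 ^ k) ≤ b - a := by
      rw [div_le_iff₀ (by positivity)]
      gcongr
    have h2 : 0 ≤ (b - a) * i / (N * 2 ^ k) := by positivity
    simp only [τ, mem_Icc]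
    constructor <;> linarith
  set A : ℕ → Set Ω := fun n => {ω | ∀ j : Σ k : Fin (n + 1), Fin (N * 2 ^ (k : ℕ) + 1),
    u + δ ≤ Y (τ j.1 j.2) ω}
  have hA (n : ℕ) : MeasurableSet (A n) := by
    simp only [A, ofPred_forall]
    exact MeasurableSet.iInter fun j => measurableSet_le measurable_const (hY _)
  have hAanti : Antitone A := fun m n hmn ω hω j =>
    hω ⟨⟨j.1, by omega⟩, ⟨j.2, j.2.2⟩⟩
  have hbound (n : ℕ) : exp (-(u + 2 * δ) ^ 2 / (2 * σ) - C * N) ≤ P.real (A n) := by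
    rw [sub_eq_add_neg, exp_add]
    exact exp_mul_exp_le_measureReal_forall_le hα hY hGY hcovY hab hσ hσ0
      (fun j => hτ (Nat.lt_succ_iff.1 j.2.2)) hu hδ.le (exp_pos _).le (hC N hN n)
  have hlim : Tendsto (fun n => P.real (A n)) atTop (nhds (P.real (⋂ n, A n))) :=
    (ENNReal.tendsto_toReal (measure_ne_top _ _)).comp
      (tendsto_measure_iInter_atTop (fun n => (hA n).nullMeasurableSet) hAanti
        ⟨0, measure_ne_top _ _⟩)
  refine (ge_of_tendsto' hlim hbound).trans ?_
  refine ENNReal.toReal_mono (measure_ne_top _ _) (measure_mono_ae ?_)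
  filter_upwards [ae_all_iff.2 fun k => ae_all_iff.2 fun i => hYX (τ k i)] with ω hω hωA t ht
  suffices h : u + δ ≤ X t ω by linarith
  have hωA' : ∀ n, ω ∈ A n := mem_iInter.1 hωA
  set i : ℕ → ℕ := fun k => ⌊(t - a) / (b - a) * (N * 2 ^ k)⌋₊
  have hi (k : ℕ) : i k ≤ N * 2 ^ k := by
    refine Nat.floor_le_of_le ?_
    push_cast
    refine mul_le_of_le_one_left (by positivity) ?_
    rw [div_le_one hL]
    linarith [ht.2]
  have hτlim : Tendsto (fun k => τ k (i k)) atTop (nhds t) := by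
    have h1 : Tendsto (fun k : ℕ => (N : ℝ) * 2 ^ k) atTop atTop :=
      (tendsto_pow_atTop_atTop_of_one_lt (by norm_num)).const_mul_atTop hN0
    have h2 := (tendsto_nat_floor_mul_div_atTop (R := ℝ) (a := (t - a) / (b - a))
      (div_nonneg (by linarith [ht.1]) hL.le)).comp h1
    have h3 := (h2.const_mul (b - a)).const_add a
    rw [mul_div_cancel₀ _ hL.ne', add_sub_cancel] at h3
    refine h3.congr fun k => ?_
    simp only [τ, i, Function.comp_apply, mul_div_assoc]
  refine ge_of_tendsto' (((hpath ω).tendsto t).comp hτlim) fun k => ?_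
  have h := hωA' k ⟨⟨k, by omega⟩, ⟨i k, Nat.lt_succ_iff.2 (hi k)⟩⟩
  simpa [hω] using h

end HighMinima

/-- Let `X` be a centered stationary Gaussian process with continuous paths
and covariance `R(t) = exp(-|t|^α)`, `0 < α ≤ 1`, and let
`σ*²(a,b) = min_{ν ∈ M₁[a,b]} ∫∫ R(t-s) ν(ds) ν(dt)`. Then there is `C ∈ (0,∞)` such
that for all sufficiently large `u`,
`log P(min_{[a,b]} X > u) ≥ -u²/(2σ*²(a,b)) - C u^{2/(α+2)}`. -/
theorem exp_alpha_covariance_high_minima_lower_bound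
    {Ω : Type*} [MeasurableSpace Ω] (P : Measure Ω) [IsProbabilityMeasure P]
    (α : ℝ) (hα : 0 < α ∧ α ≤ 1)
    (a b : ℝ) (hab : a < b)
    (X : ℝ → Ω → ℝ)
    -- centered Gaussian process
    (hGauss : ∀ (n : ℕ) (t : Fin n → ℝ) (c : Fin n → ℝ),
      ∃ v : NNReal,
        Measure.map (fun ω => ∑ i, c i * X (t i) ω) P = gaussianReal 0 v)
    -- continuous sample paths
    (hpath : ∀ ω, Continuous fun t => X t ω)
    -- stationarity, with covariance function exp(-|t|^α)
    (hcov : ∀ s t : ℝ, (∫ ω, X s ω * X t ω ∂P) = Real.exp (-(|t - s| ^ α)))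
    -- σ*²(a,b), the minimal value of the energy over M₁[a,b]
    (σsq : ℝ)
    (hσsq : σsq = sInf {x : ℝ | ∃ ν : Measure ℝ, IsProbabilityMeasure ν ∧
      ν (Icc a b)ᶜ = 0 ∧ x = statEnergy (fun t => Real.exp (-(|t| ^ α))) ν}) :
    ∃ C : ℝ, 0 < C ∧ ∀ᶠ u : ℝ in atTop,
      -(u ^ 2) / (2 * σsq) - C * u ^ ((2 : ℝ) / (α + 2)) ≤
        Real.log (P {ω | ∀ t ∈ Icc a b, u < X t ω}).toReal := by
  obtain ⟨hα0, hα1⟩ := hα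
  have hL : 0 < b - a := sub_pos.2 hab
  have hσ0 : 0 < σsq := by
    rw [hσsq]
    refine (exp_pos (-((b - a) ^ α))).trans_le (le_sInf_energySet (continuous_exp_neg_abs_rpow hα0)
      (fun t => (exp_pos _).le) exp_neg_abs_rpow_le_one hab.le fun t ht => ?_)
    gcongr
  obtain ⟨C, hC⟩ := exists_exp_le_measureReal_forall_lt hα0 hα1 hGauss hpath hcov hab hσsq hσ0
  set D : ℝ := (b - a) ^ (α / 2)
  have hD : 0 < D := by positivity
  set γ : ℝ := 2 / (α + 2) with hγ
  have hγ0 : 0 < γ := by positivity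
  refine ⟨(2 * D + 2 * D ^ 2) / σsq + 2 * |C|, by positivity, ?_⟩
  filter_upwards [eventually_ge_atTop 1] with u hu
  have hu0 : 0 < u := by linarith
  set v := u ^ γ with hv
  have hv1 : 1 ≤ v := one_le_rpow hu hγ0.le
  set N : ℕ := ⌈v⌉₊
  have hNv : v ≤ N := Nat.le_ceil v
  have hN2 : (N : ℝ) ≤ 2 * v := by linarith [Nat.ceil_lt_add_one (show 0 ≤ v by linarith)]
  have hN1 : (1 : ℝ) ≤ N := hv1.trans hNv
  set δ : ℝ := ((b - a) / N) ^ (α / 2)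
  have hδ0 : 0 ≤ δ := by positivity
  have hδD : δ ≤ D := rpow_le_rpow (by positivity) (div_le_self hL.le hN1) (by positivity)
  have hδu : u * δ ≤ D * v := by
    have h1 : δ ≤ D / v ^ (α / 2) := by
      rw [← div_rpow hL.le (by positivity)]
      exact rpow_le_rpow (by positivity) (by gcongr) (by positivity)
    have h2 : u = v * v ^ (α / 2) := by
      rw [hv, ← rpow_mul hu0.le, ← rpow_add hu0]
      conv_lhs => rw [← rpow_one u]
      congr 1
      rw [hγ]
      field_simp
      ring
    calc u * δ ≤ u * (D / v ^ (α / 2)) := by gcongr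
      _ = D * v := by
        nth_rewrite 1 [h2]
        field_simp
  have hmain := hC N (by exact_mod_cast hN1) u hu0.le
  rw [← le_log_iff_exp_le ((exp_pos _).trans_le hmain)] at hmain
  refine le_trans ?_ hmain
  have h1 : (u + 2 * δ) ^ 2 ≤ u ^ 2 + (4 * D + 4 * D ^ 2) * v := by
    have : δ ^ 2 ≤ D ^ 2 * v := by nlinarith [pow_le_pow_left₀ hδ0 hδD 2, sq_nonneg D]
    nlinarith
  have h2 : C * N ≤ 2 * |C| * v := by
    calc C * N ≤ |C| * (2 * v) := mul_le_mul (le_abs_self C) hN2 (by positivity) (abs_nonneg C)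
      _ = 2 * |C| * v := by ring
  have h3 : (u + 2 * δ) ^ 2 / (2 * σsq)
      ≤ u ^ 2 / (2 * σsq) + (2 * D + 2 * D ^ 2) / σsq * v := by
    calc (u + 2 * δ) ^ 2 / (2 * σsq) ≤ (u ^ 2 + (4 * D + 4 * D ^ 2) * v) / (2 * σsq) := by gcongr
      _ = _ := by
        field_simp
        ring
  rw [neg_div, neg_div, add_mul]
  linarith
end
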